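/- Let k be a field and A an 𝔸²-form over k (i.e., A ⊗_k L ≅ L^{[2]} for some field extension L/k). If B is any k-algebra with A^{[1]} ≅_k B^{[1]}, then A ≅_k B. In other words, 𝔸²-forms over a field are cancellative. -/

import Mathlib

/-- An exponential map (equivalently, a `𝔾ₐ`-action) on a `k`-algebra `A`:
a `k`-algebra homomorphism `φ : A → A[U]` such that evaluation at `U = 0`
is the identity and the coaction axiom `φ_V ∘ φ_U = φ_{U+V}` holds. -/
structure ExpMap (k A : Type*) [Field k] [CommRing A] [Algebra k A] where
  toFun : A →ₐ[k] Polynomial A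
  eval_zero : ∀ a : A, (toFun a).eval 0 = a
  coaction : ∀ a : A,
    (toFun a).map (toFun.toRingHom) =
      (toFun a).eval₂ (Polynomial.C.comp Polynomial.C)
        (Polynomial.X + Polynomial.C Polynomial.X)

variable {k A : Type*} [Field k] [CommRing A] [Algebra k A]

/-- The ring of invariants `A^φ = {a ∈ A : φ(a) = a}` of an exponential map. -/
def ExpMap.invariants (φ : ExpMap k A) : Subalgebra k A where
  carrier := {a : A | φ.toFun a = Polynomial.C a}
  mul_mem' := by
    intro a b ha hb
    simp only [Set.mem_setOf_eq, map_mul] at *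
    rw [ha, hb]
  add_mem' := by
    intro a b ha hb
    simp only [Set.mem_setOf_eq, map_add] at *
    rw [ha, hb]
  algebraMap_mem' := by
    intro r
    simp only [Set.mem_setOf_eq, AlgHom.commutes, Polynomial.algebraMap_apply]

/-- An exponential map is nontrivial if its ring of invariants is a proper subring. -/
def ExpMap.Nontrivial (φ : ExpMap k A) : Prop := ∃ a : A, φ.toFun a ≠ Polynomial.C a

namespace ExpMap

open Polynomial

/-- The `n`-th coefficient of an exponential map, i.e. its `n`-th higher derivation. -/
noncomputable def D (φ : ExpMap k A) (n : ℕ) : A →ₗ[k] A :=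
  (Polynomial.lcoeff A n).restrictScalars k ∘ₗ φ.toFun.toLinearMap

/-- The degree function of an exponential map. -/
noncomputable def deg (φ : ExpMap k A) (a : A) : ℕ := (φ.toFun a).natDegree

theorem D_apply (φ : ExpMap k A) (n : ℕ) (a : A) : φ.D n a = (φ.toFun a).coeff n := rfl

@[simp] theorem D_zero (φ : ExpMap k A) (a : A) : φ.D 0 a = a := by
  rw [D_apply, coeff_zero_eq_eval_zero, φ.eval_zero]

theorem coeff_coeff_eval₂_X_add_C_X (P : A[X]) (i j : ℕ) :
    ((P.eval₂ (C.comp C) (X + C X) : A[X][X]).coeff i).coeff j =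
      ((i + j).choose i : A) * P.coeff (i + j) := by
  rw [eval₂_eq_sum, Polynomial.sum, finsetSum_coeff, finsetSum_coeff]
  have h : ∀ n, ((((C.comp C : A →+* A[X][X]) (P.coeff n)) *
      (X + C X) ^ n).coeff i).coeff j = if n = i + j then
        ((i + j).choose i : A) * P.coeff (i + j) else 0 := by
    intro n
    rw [RingHom.comp_apply, coeff_C_mul, coeff_X_add_C_pow, coeff_C_mul, ← C_eq_natCast,
      coeff_mul_C, coeff_X_pow]
    rcases lt_or_ge n i with hn | hn
    · rw [Nat.choose_eq_zero_of_lt hn, if_neg (show n ≠ i + j by omega)]; simp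
    · by_cases hj : n = i + j
      · subst hj
        rw [if_pos (by omega), if_pos rfl]; ring
      · rw [if_neg (by omega), if_neg hj]; simp
  simp only [h]
  rw [Finset.sum_ite_eq']
  split_ifs with hm
  · rfl
  · rw [notMem_support_iff] at hm
    rw [hm, mul_zero]

theorem D_D (φ : ExpMap k A) (i j : ℕ) (a : A) :
    φ.D j (φ.D i a) = ((i + j).choose i : A) * φ.D (i + j) a := by
  rw [D_apply φ (i + j), ← coeff_coeff_eval₂_X_add_C_X, ← φ.coaction, coeff_map]
  rfl

/-- Higher derivations satisfying the iteration rule define an exponential map. -/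
def ofCoeff (f : A →ₐ[k] A[X]) (h0 : ∀ a, (f a).coeff 0 = a)
    (h : ∀ a i j, (f ((f a).coeff i)).coeff j =
      ((i + j).choose i : A) * (f a).coeff (i + j)) : ExpMap k A where
  toFun := f
  eval_zero a := by rw [← coeff_zero_eq_eval_zero, h0]
  coaction a := by
    ext i j
    rw [coeff_coeff_eval₂_X_add_C_X, ← h, coeff_map]
    rfl

theorem D_eq_zero {φ : ExpMap k A} {a : A} {n : ℕ} (h : φ.deg a < n) : φ.D n a = 0 :=
  coeff_eq_zero_of_natDegree_lt h

theorem deg_le_iff {φ : ExpMap k A} {a : A} {n : ℕ} :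
    φ.deg a ≤ n ↔ ∀ m, n < m → φ.D m a = 0 :=
  natDegree_le_iff_coeff_eq_zero

theorem toFun_injective (φ : ExpMap k A) : Function.Injective φ.toFun := by
  intro a b h
  rw [← φ.eval_zero a, h, φ.eval_zero]

theorem D_deg_ne_zero {φ : ExpMap k A} {a : A} (h : a ≠ 0) : φ.D (φ.deg a) a ≠ 0 := by
  have : φ.toFun a ≠ 0 := by rwa [Ne, map_eq_zero_iff _ φ.toFun_injective]
  exact leadingCoeff_ne_zero.mpr this

theorem deg_mul [IsDomain A] (φ : ExpMap k A) {a b : A} (ha : a ≠ 0) (hb : b ≠ 0) :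
    φ.deg (a * b) = φ.deg a + φ.deg b := by
  rw [deg, map_mul, natDegree_mul]
  · rfl
  · rwa [Ne, map_eq_zero_iff _ φ.toFun_injective]
  · rwa [Ne, map_eq_zero_iff _ φ.toFun_injective]

theorem mem_invariants {φ : ExpMap k A} {a : A} : a ∈ φ.invariants ↔ φ.toFun a = C a := Iff.rfl

theorem mem_invariants_iff_deg {φ : ExpMap k A} {a : A} : a ∈ φ.invariants ↔ φ.deg a = 0 := by
  rw [mem_invariants]
  constructor
  · intro h; rw [deg, h, natDegree_C]
  · intro h
    rw [deg] at h
    rw [eq_C_of_natDegree_eq_zero h, ← D_apply, D_zero]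

theorem mem_invariants_iff_D {φ : ExpMap k A} {a : A} :
    a ∈ φ.invariants ↔ ∀ n, 0 < n → φ.D n a = 0 := by
  rw [mem_invariants_iff_deg, ← Nat.le_zero, deg_le_iff]

theorem deg_D_le (φ : ExpMap k A) (i : ℕ) (a : A) : φ.deg (φ.D i a) ≤ φ.deg a - i := by
  rw [deg_le_iff]
  intro m hm
  rw [D_D, D_eq_zero (by omega), mul_zero]

theorem D_deg_mem (φ : ExpMap k A) (a : A) : φ.D (φ.deg a) a ∈ φ.invariants := by
  rw [mem_invariants_iff_deg]
  have := φ.deg_D_le (φ.deg a) a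
  omega

theorem D_mem_of_deg_le {φ : ExpMap k A} {a : A} {n : ℕ} (h : φ.deg a ≤ n) :
    φ.D n a ∈ φ.invariants := by
  rw [mem_invariants_iff_deg]
  have := φ.deg_D_le n a
  omega

theorem mem_of_mul_mem [IsDomain A] {φ : ExpMap k A} {a b : A} (hab : a * b ≠ 0)
    (h : a * b ∈ φ.invariants) : a ∈ φ.invariants ∧ b ∈ φ.invariants := by
  rw [mem_invariants_iff_deg] at *
  rw [φ.deg_mul (left_ne_zero_of_mul hab) (right_ne_zero_of_mul hab)] at h
  rw [mem_invariants_iff_deg]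
  omega

theorem D_mul_of_mem {φ : ExpMap k A} {a : A} (h : a ∈ φ.invariants) (b : A) (n : ℕ) :
    φ.D n (a * b) = a * φ.D n b := by
  rw [D_apply, map_mul, mem_invariants.mp h, coeff_C_mul, D_apply]

theorem deg_add_le {φ : ExpMap k A} {a b : A} {n : ℕ} (ha : φ.deg a ≤ n) (hb : φ.deg b ≤ n) :
    φ.deg (a + b) ≤ n := by
  rw [deg, map_add]
  exact natDegree_add_le_of_degree_le ha hb

theorem deg_mul_le_of_mem {φ : ExpMap k A} {a b : A} {n : ℕ} (ha : a ∈ φ.invariants)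
    (hb : φ.deg b ≤ n) : φ.deg (a * b) ≤ n := by
  rw [deg_le_iff] at *
  intro m hm
  rw [D_mul_of_mem ha, hb m hm, mul_zero]

/-- `d` is the least positive value of the degree function. -/
def IsMinDeg (φ : ExpMap k A) (d : ℕ) : Prop :=
  0 < d ∧ (∃ x, φ.deg x = d) ∧ ∀ a, φ.deg a < d → φ.deg a = 0

theorem Nontrivial.exists_isMinDeg {φ : ExpMap k A} (h : φ.Nontrivial) : ∃ d, φ.IsMinDeg d := by
  classical
  obtain ⟨a, ha⟩ := h
  have hex : ∃ n, 0 < n ∧ ∃ x, φ.deg x = n :=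
    ⟨φ.deg a, Nat.pos_of_ne_zero fun h0 => ha (mem_invariants_iff_deg.mpr h0), a, rfl⟩
  refine ⟨Nat.find hex, (Nat.find_spec hex).1, (Nat.find_spec hex).2, fun b hb => ?_⟩
  by_contra h0
  exact Nat.find_min hex hb ⟨Nat.pos_of_ne_zero h0, b, rfl⟩

theorem IsMinDeg.mem_of_lt {φ : ExpMap k A} {d : ℕ} (hd : φ.IsMinDeg d) {a : A}
    (h : φ.deg a < d) : a ∈ φ.invariants :=
  mem_invariants_iff_deg.mpr (hd.2.2 a h)

theorem IsMinDeg.choose_eq_zero [IsDomain A] {φ : ExpMap k A} {d : ℕ} (hd : φ.IsMinDeg d)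
    {i : ℕ} (hi : 0 < i) (hid : i < d) : (d.choose i : A) = 0 := by
  obtain ⟨x, hx⟩ := hd.2.1
  have hx0 : x ≠ 0 := by
    rintro rfl
    have := hd.1
    simp [deg] at hx
    omega
  have h1 : φ.D i x ∈ φ.invariants := by
    apply hd.mem_of_lt
    have := φ.deg_D_le i x
    omega
  have h2 := φ.D_D i (d - i) x
  rw [mem_invariants_iff_D.mp h1 _ (by omega), Nat.add_sub_cancel' hid.le] at h2
  have h3 := D_deg_ne_zero (φ := φ) hx0
  rw [hx] at h3
  exact (mul_eq_zero.mp h2.symm).resolve_right h3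

theorem _root_.Nat.cast_choose_mul_add_eq_one {R : Type*} [CommRing R] {d : ℕ} (hd : 0 < d)
    (h : ∀ i, 0 < i → i < d → (d.choose i : R) = 0) (q r : ℕ) (hr : r < d) :
    ((q * d + r).choose r : R) = 1 := by
  have h1 : (1 + X : R[X]) ^ d = 1 + X ^ d := by
    ext n
    rw [coeff_one_add_X_pow, coeff_add, coeff_one, coeff_X_pow]
    rcases Nat.eq_zero_or_pos n with rfl | hn
    · simp [hd.ne]
    · rcases lt_trichotomy n d with hnd | rfl | hnd
      · rw [h n hn hnd]; simp [hn.ne', hnd.ne]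
      · simp [hn.ne']
      · rw [Nat.choose_eq_zero_of_lt hnd]; simp [hn.ne', hnd.ne']
  have h2 : (1 + X : R[X]) ^ (q * d + r) = (1 + X ^ d) ^ q * (1 + X) ^ r := by
    rw [pow_add, mul_comm q d, pow_mul, h1]
  have h3 := congrArg (fun p => coeff p r) h2
  simp only [coeff_one_add_X_pow] at h3
  obtain ⟨g, hg⟩ : ∃ g : R[X], (1 + X ^ d) ^ q = 1 + X ^ d * g := by
    have : (X ^ d : R[X]) ∣ (1 + X ^ d) ^ q - 1 ^ q :=
      dvd_trans (by simp) (sub_dvd_pow_sub_pow _ _ q)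
    obtain ⟨g, hg⟩ := this
    exact ⟨g, by rw [← hg]; ring⟩
  rw [h3, hg, add_mul, one_mul, coeff_add, coeff_one_add_X_pow, mul_assoc, coeff_X_pow_mul',
    if_neg (by omega)]
  simp

theorem IsMinDeg.dvd_deg [IsDomain A] {φ : ExpMap k A} {d : ℕ} (hd : φ.IsMinDeg d) (a : A) :
    d ∣ φ.deg a := by
  by_cases ha : a = 0
  · subst ha; simp [deg]
  by_contra hdvd
  set n := φ.deg a with hn
  have hr : 0 < n % d := Nat.pos_of_ne_zero fun h => hdvd (Nat.dvd_of_mod_eq_zero h)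
  have hr' : n % d < d := Nat.mod_lt _ hd.1
  have hle : n % d ≤ n := Nat.mod_le _ _
  have h1 := φ.D_D (n - n % d) (n % d) a
  have h2 : φ.D (n - n % d) a ∈ φ.invariants := by
    apply hd.mem_of_lt
    have := φ.deg_D_le (n - n % d) a
    omega
  rw [mem_invariants_iff_D.mp h2 _ hr, Nat.sub_add_cancel hle] at h1
  have h3 := Nat.cast_choose_mul_add_eq_one (R := A) hd.1 (fun i => hd.choose_eq_zero) (n / d) _ hr'
  rw [mul_comm (n / d) d, Nat.div_add_mod] at h3
  rw [Nat.choose_symm hle, h3, one_mul] at h1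
  exact D_deg_ne_zero ha h1.symm

theorem deg_aeval [IsDomain A] (φ : ExpMap k A) (P : φ.invariants[X]) (x : A) :
    φ.deg (aeval x P) = P.natDegree * φ.deg x := by
  have h : φ.toFun (aeval x P) = (P.map (algebraMap φ.invariants A)).comp (φ.toFun x) := by
    induction P using Polynomial.induction_on' with
    | add p q hp hq => rw [map_add, map_add, hp, hq, Polynomial.map_add, add_comp]
    | monomial n c =>
      have hc : φ.toFun (c : A) = C (c : A) := c.2
      rw [aeval_monomial, map_mul, map_pow, Polynomial.map_monomial, monomial_comp]
      exact congrArg (· * _) hc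
  rw [deg, h, natDegree_comp, natDegree_map_eq_of_injective Subtype.val_injective, deg]

theorem deg_pow [IsDomain A] (φ : ExpMap k A) (x : A) (n : ℕ) :
    φ.deg (x ^ n) = n * φ.deg x := by
  rw [deg, map_pow, natDegree_pow, deg]

theorem IsMinDeg.exists_pow_mul_eq_aeval [IsDomain A] {φ : ExpMap k A} {d : ℕ}
    (hd : φ.IsMinDeg d) {x : A} (hx : φ.deg x = d) (a : A) :
    ∃ (m : ℕ) (P : φ.invariants[X]), φ.D d x ^ m * a = aeval x P := by
  induction hn : φ.deg a using Nat.strong_induction_on generalizing a with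
  | _ n ih =>
    have hc : φ.D d x ∈ φ.invariants := hx ▸ φ.D_deg_mem x
    rcases Nat.eq_zero_or_pos n with h0 | hpos
    · exact ⟨0, C ⟨a, mem_invariants_iff_deg.mpr (hn.trans h0)⟩, by simp⟩
    obtain ⟨q, hq⟩ := hd.dvd_deg a
    have hq' : n = q * d := by rw [← hn, hq, mul_comm]
    set b := φ.D d x ^ q * a - φ.D n a * x ^ q with hb
    have hla : φ.D n a ∈ φ.invariants := hn ▸ φ.D_deg_mem a
    have hcq : φ.D d x ^ q ∈ φ.invariants := pow_mem hc q
    have hxq : φ.D n (x ^ q) = φ.D d x ^ q := by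
      rw [D_apply, map_pow, hq', coeff_pow_of_natDegree_le hx.le]; rfl
    have hlt : φ.deg b < n := by
      have hle : φ.deg b ≤ n := by
        rw [hb, sub_eq_add_neg, ← mul_neg]
        refine deg_add_le (deg_mul_le_of_mem hcq hn.le) (deg_mul_le_of_mem hla ?_)
        rw [deg, map_neg, natDegree_neg]
        exact (φ.deg_pow x q).trans (by rw [hx, hq']) |>.le
      have hz : φ.D n b = 0 := by
        rw [hb, map_sub, D_mul_of_mem hcq, D_mul_of_mem hla, hxq]; ring
      rcases hle.lt_or_eq with h | h
      · exact h
      · exfalso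
        by_cases hb0 : b = 0
        · rw [hb0] at h; simp [deg] at h; omega
        · exact D_deg_ne_zero hb0 (h ▸ hz)
    obtain ⟨m, P, hP⟩ := ih _ hlt b rfl
    refine ⟨m + q, P + C (⟨_, pow_mem hc m⟩ * ⟨_, hla⟩) * X ^ q, ?_⟩
    rw [map_add, ← hP, map_mul, aeval_C, map_pow, aeval_X, hb]
    change _ = _ + (φ.D d x ^ m * φ.D n a) * x ^ q
    ring

end ExpMap

/-! ### Algebras over an algebraically closed field whose cylinder is affine 3-space -/

section Cylinder

open Polynomial

variable {L E : Type*} [Field L] [CommRing E] [Algebra L E]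

/-- The total degree on an algebra `E` induced by an isomorphism `E[X] ≃ L[x₀, x₁, x₂]`. -/
noncomputable def cylDeg (σ : E[X] ≃ₐ[L] MvPolynomial (Fin 3) L) (a : E) : ℕ :=
  (σ (C a)).totalDegree

variable (σ : E[X] ≃ₐ[L] MvPolynomial (Fin 3) L)

theorem isDomain_of_cylinder (σ : E[X] ≃ₐ[L] MvPolynomial (Fin 3) L) : IsDomain E := by
  have : IsDomain E[X] := σ.toMulEquiv.isDomain _
  exact Function.Injective.isDomain (C : E →+* E[X]) C_injective

theorem cylDeg_mul [IsDomain E] {a b : E} (ha : a ≠ 0) (hb : b ≠ 0) :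
    cylDeg σ (a * b) = cylDeg σ a + cylDeg σ b := by
  rw [cylDeg, C_mul, map_mul, MvPolynomial.totalDegree_mul_of_isDomain]
  · rfl
  · simpa using ha
  · simpa using hb

theorem cylDeg_algebraMap (l : L) : cylDeg σ (algebraMap L E l) = 0 := by
  have : (C (algebraMap L E l) : E[X]) = algebraMap L E[X] l := rfl
  rw [cylDeg, this, AlgEquiv.commutes, MvPolynomial.algebraMap_eq, MvPolynomial.totalDegree_C]

theorem exists_algebraMap_of_cylDeg_eq_zero {a : E} (h : cylDeg σ a = 0) :
    ∃ l : L, algebraMap L E l = a := by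
  rw [cylDeg, MvPolynomial.totalDegree_eq_zero_iff_eq_C] at h
  refine ⟨MvPolynomial.coeff 0 (σ (C a)), C_injective (σ.injective (Eq.trans ?_ h.symm))⟩
  have : (C (algebraMap L E (MvPolynomial.coeff 0 (σ (C a)))) : E[X]) = algebraMap L E[X] _ := rfl
  rw [this, AlgEquiv.commutes, MvPolynomial.algebraMap_eq]

theorem cylDeg_sub_algebraMap_le (a : E) (l : L) :
    cylDeg σ (a - algebraMap L E l) ≤ cylDeg σ a := by
  have : (C (algebraMap L E l) : E[X]) = algebraMap L E[X] l := rfl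
  rw [cylDeg, C_sub, map_sub, this, AlgEquiv.commutes, MvPolynomial.algebraMap_eq]
  refine (MvPolynomial.totalDegree_sub _ _).trans ?_
  simp [cylDeg]

theorem cylDeg_eq_zero_of_isUnit {a : E} (h : IsUnit a) : cylDeg σ a = 0 :=
  (MvPolynomial.isUnit_iff_totalDegree_of_isReduced.mp
    ((h.map (C : E →+* E[X])).map σ)).2

theorem prime_of_irreducible_of_cylinder (σ : E[X] ≃ₐ[L] MvPolynomial (Fin 3) L) [IsDomain E]
    {p : E} (hp : Irreducible p) : Prime p := by
  rw [← prime_C_iff, ← MulEquiv.prime_iff σ]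
  refine UniqueFactorizationMonoid.irreducible_iff_prime.mp ?_
  rw [MulEquiv.irreducible_iff]
  refine ⟨fun h => hp.not_isUnit (isUnit_C.mp h), fun u v huv => ?_⟩
  have h0 : u * v ≠ 0 := by rw [← huv]; exact C_ne_zero.mpr hp.ne_zero
  have hd := congrArg natDegree huv
  rw [natDegree_C, natDegree_mul (left_ne_zero_of_mul h0) (right_ne_zero_of_mul h0)] at hd
  rw [eq_C_of_natDegree_eq_zero (p := u) (by omega),
    eq_C_of_natDegree_eq_zero (p := v) (by omega), ← C_mul] at huv
  rw [eq_C_of_natDegree_eq_zero (p := u) (by omega),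
    eq_C_of_natDegree_eq_zero (p := v) (by omega), isUnit_C, isUnit_C]
  exact hp.isUnit_or_isUnit (C_injective huv)

theorem trdeg_add_one_of_cylinder (σ : E[X] ≃ₐ[L] MvPolynomial (Fin 3) L) [IsDomain E] :
    Algebra.trdeg L E + 1 = 3 := by
  have h3 : Algebra.trdeg L E[X] = 3 := by
    have h := σ.lift_trdeg_eq
    rw [MvPolynomial.trdeg_of_isDomain] at h
    simpa using h
  have h4 := trdeg_add_eq L E (A := E[X])
  rwa [Polynomial.trdeg_of_isDomain, h3] at h4

namespace ExpMap

variable {σ}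

theorem exists_dvd_sub_algebraMap [IsAlgClosed L] [IsDomain E] {p g : E} (hp : Prime p) {Q : L[X]}
    (hQ : Q ≠ 0) (h : p ∣ aeval g Q) : ∃ l : L, p ∣ g - algebraMap L E l := by
  have hs := (IsAlgClosed.splits Q).eq_prod_roots
  rw [hs, map_mul, aeval_C, map_multiset_prod, Multiset.map_map] at h
  rcases hp.dvd_or_dvd h with h | h
  · exact absurd (isUnit_of_dvd_unit h ((isUnit_iff_ne_zero.mpr
      (leadingCoeff_ne_zero.mpr hQ)).map (algebraMap L E))) hp.not_isUnit
  · obtain ⟨l, -, hl⟩ := hp.exists_mem_multiset_map_dvd h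
    exact ⟨l, by simpa using hl⟩

theorem isAlgebraic_adjoin_of_mem_invariants (σ : E[X] ≃ₐ[L] MvPolynomial (Fin 3) L) [IsDomain E]
    {φ : ExpMap L E} (hφ : φ.Nontrivial)
    {g : φ.invariants} (hg : Transcendental L g) (p : φ.invariants) :
    IsAlgebraic (Algebra.adjoin L {g}) p := by
  have htr : Algebra.Transcendental φ.invariants E := by
    obtain ⟨x, hx⟩ := hφ
    refine ⟨x, fun ⟨P, hP0, hP⟩ => hP0 ?_⟩
    have h1 := φ.deg_aeval P x
    rw [hP] at h1
    have h2 : φ.deg x ≠ 0 := fun h => hx (mem_invariants_iff_deg.mpr h)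
    have h3 : P.natDegree = 0 := by
      rcases mul_eq_zero.mp (h1.symm.trans (by simp [deg])) with h | h
      exacts [h, absurd h h2]
    rw [eq_C_of_natDegree_eq_zero h3] at hP ⊢
    rw [aeval_C] at hP
    rw [(FaithfulSMul.algebraMap_injective φ.invariants E) (hP.trans (map_zero _).symm), C_0]
  have h4 := trdeg_add_one_of_cylinder σ
  have h5 := trdeg_add_eq L φ.invariants (A := E)
  have : FaithfulSMul L (Algebra.adjoin L {g}) :=
    (faithfulSMul_iff_algebraMap_injective _ _).mpr (algebraMap L _).injective
  have h6 := trdeg_add_eq L (Algebra.adjoin L {g}) (A := φ.invariants)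
  have h7 : 1 ≤ Algebra.trdeg φ.invariants E :=
    Cardinal.one_le_iff_pos.mpr (trdeg_pos _ _)
  have h8 : 1 ≤ Algebra.trdeg L (Algebra.adjoin L {g}) := by
    have : Algebra.Transcendental L (Algebra.adjoin L {g}) :=
      ⟨⟨g, Algebra.self_mem_adjoin_singleton L g⟩, fun h => hg (h.algHom (Subalgebra.val _))⟩
    exact Cardinal.one_le_iff_pos.mpr (trdeg_pos _ _)
  rw [← h5, ← h6] at h4
  have hfin : ∀ c : Cardinal, c ≤ 3 → c < Cardinal.aleph0 := fun c hc =>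
    hc.trans_lt (Cardinal.natCast_lt_aleph0 (n := 3))
  have h9 : Algebra.trdeg (Algebra.adjoin L {g}) φ.invariants = 0 := by
    generalize Algebra.trdeg L (Algebra.adjoin L {g}) = a at h4 h8
    generalize Algebra.trdeg (Algebra.adjoin L {g}) φ.invariants = b at h4
    generalize Algebra.trdeg φ.invariants E = c at h4 h7
    have hab : a + b ≤ 3 := h4 ▸ (le_self_add.trans le_self_add)
    lift a to ℕ using hfin a (le_self_add.trans hab)
    lift b to ℕ using hfin b ((self_le_add_left _ _).trans hab)
    lift c to ℕ using hfin c (h4 ▸ (self_le_add_left _ _).trans le_self_add)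
    norm_cast at *
    omega
  exact (trdeg_eq_zero_iff.mp h9).isAlgebraic p

theorem dvd_algebraMap_coeff_zero {R S : Type*} [CommRing R] [CommRing S] [Algebra R S] {x : S}
    {q : R[X]} (hq : aeval x q = 0) : x ∣ algebraMap R S (q.coeff 0) := by
  rw [← q.divX_mul_X_add, map_add, map_mul, aeval_X, aeval_C] at hq
  exact ⟨-aeval x q.divX, by linear_combination hq⟩

theorem exists_mul_algebraMap_add_of_forall {R : Type*} [CommRing R] [Algebra L R] {p : R}
    (hp : ∀ c : R, ∃ l : L, ∃ c', c = p * c' + algebraMap L R l) (P : R[X]) :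
    ∃ (P' : R[X]) (Q : L[X]), P = C p * P' + Q.map (algebraMap L R) := by
  induction P using Polynomial.induction_on' with
  | add P₁ P₂ h₁ h₂ =>
    obtain ⟨P₁', Q₁, h₁⟩ := h₁
    obtain ⟨P₂', Q₂, h₂⟩ := h₂
    exact ⟨P₁' + P₂', Q₁ + Q₂, by rw [Polynomial.map_add, h₁, h₂]; ring⟩
  | monomial n c =>
    obtain ⟨l, c', h⟩ := hp c
    exact ⟨monomial n c', monomial n l, by
      rw [Polynomial.map_monomial, C_mul_monomial, ← map_add, ← h]⟩

theorem sub_algebraMap_mem_invariants {φ : ExpMap L E} {a : E} (ha : a ∈ φ.invariants) (l : L) :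
    a - algebraMap L E l ∈ φ.invariants :=
  sub_mem ha (φ.invariants.algebraMap_mem l)

/-- The invariant ring of a nontrivial exponential map on a cancellation-type surface over an
algebraically closed field is generated by one element `f`, all of whose translates are prime. -/
theorem exists_generator_invariants (σ : E[X] ≃ₐ[L] MvPolynomial (Fin 3) L) [IsAlgClosed L]
    [IsDomain E] {φ : ExpMap L E} {g : E} (hgC : g ∈ φ.invariants) (hg : cylDeg σ g ≠ 0)
    (hφ : φ.Nontrivial) :
    ∃ f ∈ φ.invariants, cylDeg σ f ≠ 0 ∧ (∀ l : L, Prime (f - algebraMap L E l)) ∧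
      ∀ c ∈ φ.invariants, ∃ P : L[X], c = aeval f P := by
  classical
  have hex : ∃ n, ∃ f ∈ φ.invariants, cylDeg σ f ≠ 0 ∧ cylDeg σ f = n := ⟨_, g, hgC, hg, rfl⟩
  obtain ⟨f, hfC, hf0, hfn⟩ := Nat.find_spec hex
  have hmin : ∀ a ∈ φ.invariants, cylDeg σ a ≠ 0 → cylDeg σ f ≤ cylDeg σ a := fun a ha ha0 =>
    hfn ▸ Nat.find_min' hex ⟨a, ha, ha0, rfl⟩
  have hnc : ∀ (a : E) (l : L), cylDeg σ a ≠ 0 → cylDeg σ (a - algebraMap L E l) ≠ 0 := by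
    intro a l ha h
    obtain ⟨m, hm⟩ := exists_algebraMap_of_cylDeg_eq_zero σ h
    apply ha
    rw [← sub_add_cancel a (algebraMap L E l), ← hm, ← map_add, cylDeg_algebraMap]
  have hne : ∀ a : E, cylDeg σ a ≠ 0 → a ≠ 0 := by
    rintro a ha rfl
    exact ha (by simpa using cylDeg_algebraMap σ 0)
  have hprime : ∀ l : L, Prime (f - algebraMap L E l) := by
    intro l
    have hl := hnc f l hf0
    refine prime_of_irreducible_of_cylinder σ ⟨fun h => hl (cylDeg_eq_zero_of_isUnit σ h), ?_⟩
    intro a b hab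
    have h0 : a * b ≠ 0 := hab ▸ hne _ hl
    obtain ⟨ha, hb⟩ := mem_of_mul_mem h0 (hab ▸ sub_algebraMap_mem_invariants hfC l)
    have hm := cylDeg_mul σ (left_ne_zero_of_mul h0) (right_ne_zero_of_mul h0)
    rw [← hab] at hm
    have hle := cylDeg_sub_algebraMap_le σ f l
    have hu : ∀ c : E, c ≠ 0 → cylDeg σ c = 0 → IsUnit c := by
      intro c hc h
      obtain ⟨m, rfl⟩ := exists_algebraMap_of_cylDeg_eq_zero σ h
      exact (isUnit_iff_ne_zero.mpr fun h => hc (by rw [h, map_zero])).map (algebraMap L E)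
    by_cases ha0 : cylDeg σ a = 0
    · exact Or.inl (hu a (left_ne_zero_of_mul h0) ha0)
    by_cases hb0 : cylDeg σ b = 0
    · exact Or.inr (hu b (right_ne_zero_of_mul h0) hb0)
    have := hmin a ha ha0
    omega
  refine ⟨f, hfC, hf0, hprime, fun c hc => ?_⟩
  induction hn : cylDeg σ c using Nat.strong_induction_on generalizing c with
  | _ n ih =>
    by_cases hn0 : cylDeg σ c = 0
    · obtain ⟨m, rfl⟩ := exists_algebraMap_of_cylDeg_eq_zero σ hn0
      exact ⟨C m, by simp⟩
    obtain ⟨l, c', hc'⟩ : ∃ l : L, f ∣ c - algebraMap L E l := by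
      have hcoe : ∀ P : L[X], aeval c P = ((aeval (⟨c, hc⟩ : φ.invariants) P : φ.invariants) : E) :=
        fun P => aeval_algHom_apply φ.invariants.val (⟨c, hc⟩ : φ.invariants) P
      by_cases htr : IsAlgebraic L (⟨c, hc⟩ : φ.invariants)
      · obtain ⟨P, hP0, hP⟩ := htr
        exact exists_dvd_sub_algebraMap (by simpa using hprime 0) hP0 (by simp [hcoe, hP])
      have halg := isAlgebraic_adjoin_of_mem_invariants σ hφ htr ⟨f, hfC⟩
      have hf0 : (⟨f, hfC⟩ : φ.invariants) ≠ 0 := fun h => hne f hf0 (congrArg Subtype.val h)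
      obtain ⟨q, hq0, hq⟩ := halg.exists_nonzero_coeff_and_aeval_eq_zero
        (mem_nonZeroDivisors_of_ne_zero hf0)
      obtain ⟨Q, hQ⟩ := (Algebra.adjoin_singleton_eq_range_aeval L _).le (q.coeff 0).2
      have hdvd : (⟨f, hfC⟩ : φ.invariants) ∣ (q.coeff 0 : φ.invariants) :=
        dvd_algebraMap_coeff_zero hq
      refine exists_dvd_sub_algebraMap (by simpa using hprime 0) (Q := Q) ?_ ?_
      · rintro rfl
        exact hq0 (Subtype.ext (by simpa using hQ.symm))
      · obtain ⟨u, hu⟩ := hdvd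
        refine ⟨u, ?_⟩
        rw [hcoe]
        exact congrArg Subtype.val (hQ.trans hu)
    have h0 : c - algebraMap L E l ≠ 0 := hne _ (hnc c l hn0)
    rw [hc'] at h0
    have hc'C := (mem_of_mul_mem h0 (hc' ▸ sub_algebraMap_mem_invariants hc l)).2
    have hm := cylDeg_mul σ (left_ne_zero_of_mul h0) (right_ne_zero_of_mul h0)
    have hle := cylDeg_sub_algebraMap_le σ c l
    rw [hc'] at hle
    obtain ⟨P, hP⟩ := ih _ (by omega) c' hc'C rfl
    exact ⟨X * P + C l, by rw [map_add, map_mul, aeval_X, aeval_C, ← hP, ← hc', sub_add_cancel]⟩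

/-- Over an algebraically closed field, a nontrivial exponential map on an algebra whose cylinder
is affine `3`-space has a slice up to higher order: the algebra is generated over the invariants
by an element of minimal positive degree. -/
theorem IsMinDeg.exists_forall_eq_aeval (σ : E[X] ≃ₐ[L] MvPolynomial (Fin 3) L) [IsAlgClosed L]
    [IsDomain E] {φ : ExpMap L E} {d : ℕ} (hd : φ.IsMinDeg d) {f : E} (hfC : f ∈ φ.invariants)
    (hf0 : cylDeg σ f ≠ 0) (hprime : ∀ l : L, Prime (f - algebraMap L E l))
    (hgen : ∀ c ∈ φ.invariants, ∃ P : L[X], c = aeval f P) :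
    ∃ s, φ.deg s = d ∧ ∀ a, ∃ P : φ.invariants[X], a = aeval s P := by
  classical
  have hne : ∀ {x}, φ.deg x = d → φ.D d x ≠ 0 := by
    rintro x rfl
    refine D_deg_ne_zero ?_
    rintro rfl
    exact hd.1.ne' (by simp [deg])
  have hex : ∃ n x, φ.deg x = d ∧ cylDeg σ (φ.D d x) = n := by
    obtain ⟨x, hx⟩ := hd.2.1
    exact ⟨_, x, hx, rfl⟩
  obtain ⟨s, hs, hsn⟩ := Nat.find_spec hex
  have hmin : ∀ x, φ.deg x = d → cylDeg σ (φ.D d s) ≤ cylDeg σ (φ.D d x) := fun x hx =>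
    hsn ▸ Nat.find_min' hex ⟨x, hx, rfl⟩
  have hfl : ∀ l : L, cylDeg σ (f - algebraMap L E l) ≠ 0 := by
    intro l h
    obtain ⟨m, hm⟩ := exists_algebraMap_of_cylDeg_eq_zero σ h
    apply hf0
    rw [← sub_add_cancel f (algebraMap L E l), ← hm, ← map_add, cylDeg_algebraMap]
  have hflC := sub_algebraMap_mem_invariants (L := L) hfC
  have hres : ∀ (l : L) (P : φ.invariants[X]), (f - algebraMap L E l) ∣ aeval s P →
      ∃ P' : φ.invariants[X], P = C ⟨f - algebraMap L E l, hflC l⟩ * P' := by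
    intro l P hdvd
    have hdec : ∀ c : φ.invariants, ∃ (m : L) (c' : φ.invariants),
        c = ⟨f - algebraMap L E l, hflC l⟩ * c' + algebraMap L φ.invariants m := by
      intro c
      obtain ⟨R, hR⟩ := hgen c c.2
      obtain ⟨R', hR'⟩ : X - C l ∣ R - C (R.eval l) := by
        rw [dvd_iff_isRoot]; simp
      refine ⟨R.eval l, aeval ⟨f, hfC⟩ R', Subtype.ext ?_⟩
      have h1 : ∀ P : L[X], aeval f P = ((aeval (⟨f, hfC⟩ : φ.invariants) P : φ.invariants) : E) :=
        fun P => aeval_algHom_apply φ.invariants.val (⟨f, hfC⟩ : φ.invariants) P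
      have h2 := congrArg (aeval f) hR'
      rw [map_sub, map_mul, map_sub, aeval_X, aeval_C, aeval_C, ← hR, h1 R'] at h2
      exact sub_eq_iff_eq_add.mp h2
    obtain ⟨P', Q, hPQ⟩ := exists_mul_algebraMap_add_of_forall hdec P
    refine ⟨P', ?_⟩
    suffices Q = 0 by rw [hPQ, this, Polynomial.map_zero, add_zero]
    by_contra hQ
    have hdvd' : f - algebraMap L E l ∣ aeval s Q := by
      rw [hPQ, map_add, map_mul, aeval_C, aeval_map_algebraMap] at hdvd
      exact (dvd_add_right ⟨_, rfl⟩).mp hdvd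
    obtain ⟨m, x, hx⟩ := exists_dvd_sub_algebraMap (hprime l) hQ hdvd'
    have hD : φ.D d s = (f - algebraMap L E l) * φ.D d x := by
      rw [← D_mul_of_mem (hflC l), ← hx, map_sub, sub_eq_self.mpr]
      exact mem_invariants_iff_D.mp (φ.invariants.algebraMap_mem m) d hd.1
    have hx0 : φ.D d x ≠ 0 := fun h => hne hs (by rw [hD, h, mul_zero])
    have hxd : φ.deg x = d := by
      have h1 : (f - algebraMap L E l) * x ≠ 0 := fun h =>
        mul_ne_zero (hprime l).ne_zero hx0 (by rw [← D_mul_of_mem (hflC l), h, map_zero])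
      have h2 := φ.deg_mul (left_ne_zero_of_mul h1) (right_ne_zero_of_mul h1)
      rw [mem_invariants_iff_deg.mp (hflC l), zero_add, ← hx, sub_eq_add_neg, ← map_neg] at h2
      have h3 : φ.deg (s + algebraMap L E (-m)) ≤ d := deg_add_le hs.le
        ((mem_invariants_iff_deg.mp (φ.invariants.algebraMap_mem _)).le.trans d.zero_le)
      rcases (h2 ▸ h3).lt_or_eq with h | h
      · exact absurd (D_eq_zero h) hx0
      · exact h
    have h1 := hmin x hxd
    have h2 := hfl l
    rw [hD, cylDeg_mul σ (hprime l).ne_zero hx0] at h1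
    omega
  have hdiv : ∀ n, ∀ c ∈ φ.invariants, c ≠ 0 → cylDeg σ c = n →
      ∀ (a : E) (P : φ.invariants[X]), c * a = aeval s P → ∃ P' : φ.invariants[X], a = aeval s P' := by
    intro n
    induction n using Nat.strong_induction_on with
    | _ n ih =>
      intro c hc hc0 hcn a P hP
      obtain ⟨R, hR⟩ := hgen c hc
      by_cases hdeg : R.degree = 0
      · rw [eq_C_of_degree_eq_zero hdeg, aeval_C] at hR
        set m := R.coeff 0
        have hm : m ≠ 0 := by rintro h; exact hc0 (by rw [hR, h, map_zero])
        refine ⟨C (algebraMap L _ m⁻¹) * P, ?_⟩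
        rw [map_mul, ← hP, aeval_C, ← IsScalarTower.algebraMap_apply, hR, ← mul_assoc, ← map_mul,
          inv_mul_cancel₀ hm, map_one, one_mul]
      · obtain ⟨l, hl⟩ := IsAlgClosed.exists_root R hdeg
        obtain ⟨R', rfl⟩ := dvd_iff_isRoot.mpr hl
        rw [map_mul, map_sub, aeval_X, aeval_C] at hR
        rw [hR] at hc0 hc
        have hc' := (mem_of_mul_mem hc0 hc).2
        have hm := cylDeg_mul σ (left_ne_zero_of_mul hc0) (right_ne_zero_of_mul hc0)
        have := hfl l
        rw [hR, mul_assoc] at hP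
        obtain ⟨P', rfl⟩ := hres l P ⟨_, hP.symm⟩
        rw [map_mul, aeval_C] at hP
        exact ih _ (by rw [← hcn, hR]; omega) _ hc' (right_ne_zero_of_mul hc0) rfl a P'
          (mul_left_cancel₀ (hprime l).ne_zero hP)
  refine ⟨s, hs, fun a => ?_⟩
  obtain ⟨m, P, hP⟩ := hd.exists_pow_mul_eq_aeval hs a
  exact hdiv _ _ (pow_mem (hs ▸ φ.D_deg_mem s) m) (pow_ne_zero m (hne hs)) rfl a P hP

theorem exists_mem_invariants_cylDeg_ne_zero (σ : E[X] ≃ₐ[L] MvPolynomial (Fin 3) L) [IsDomain E]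
    {φ : ExpMap L E} {d : ℕ} (hd : φ.IsMinDeg d) : ∃ g ∈ φ.invariants, cylDeg σ g ≠ 0 := by
  by_contra! hcon
  have hC : ∀ c : φ.invariants, ∃ l : L, algebraMap L φ.invariants l = c := by
    intro c
    obtain ⟨l, hl⟩ := exists_algebraMap_of_cylDeg_eq_zero σ (hcon c c.2)
    exact ⟨l, Subtype.ext hl⟩
  obtain ⟨x, hx⟩ := hd.2.1
  have hx0 : x ≠ 0 := by
    rintro rfl
    exact hd.1.ne' (by rw [← hx]; simp [deg])
  have hsurj : Function.Surjective (aeval x : L[X] →ₐ[L] E) := by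
    intro a
    obtain ⟨m, P, hP⟩ := hd.exists_pow_mul_eq_aeval hx a
    obtain ⟨l, hl⟩ := hC ⟨φ.D d x, hx ▸ φ.D_deg_mem x⟩
    have hl' : algebraMap L E l = φ.D d x := congrArg Subtype.val hl
    have hl0 : l ≠ 0 := by
      rintro rfl
      rw [map_zero] at hl'
      exact D_deg_ne_zero hx0 (hx ▸ hl'.symm)
    obtain ⟨Q, rfl⟩ := Polynomial.map_surjective (algebraMap L φ.invariants) hC P
    refine ⟨C (l⁻¹ ^ m) * Q, ?_⟩
    rw [aeval_map_algebraMap] at hP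
    rw [map_mul, aeval_C, ← hP, ← hl', ← map_pow, ← mul_assoc, ← map_mul, ← mul_pow,
      inv_mul_cancel₀ hl0, one_pow, map_one, one_mul]
  have h1 := lift_trdeg_le_of_surjective _ hsurj
  rw [Polynomial.trdeg_of_isDomain, Cardinal.lift_one, Cardinal.lift_le_one_iff] at h1
  have h2 : (3 : Cardinal) ≤ 1 + 1 := trdeg_add_one_of_cylinder σ ▸ add_le_add_left h1 1
  norm_cast at h2

theorem aeval_injective_of_sub_algebraMap_ne_zero [IsAlgClosed L] [IsDomain E] {f : E}
    (h : ∀ l : L, f - algebraMap L E l ≠ 0) :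
    Function.Injective (aeval f : L[X] →ₐ[L] E) := by
  rw [injective_iff_map_eq_zero]
  intro Q hQ
  by_contra hQ0
  rw [(IsAlgClosed.splits Q).eq_prod_roots, map_mul, aeval_C, map_multiset_prod, Multiset.map_map,
    mul_eq_zero, Multiset.prod_eq_zero_iff, map_eq_zero, leadingCoeff_eq_zero] at hQ
  obtain hQ | hQ := hQ
  · exact hQ0 hQ
  · obtain ⟨l, -, hl⟩ := Multiset.mem_map.mp hQ
    exact h l (by simpa using hl)

end ExpMap

end Cylinder

/-! ### Base change of exponential maps -/

section BaseChange

open Polynomial TensorProduct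

namespace ExpMap

variable (L : Type*) [Field L] [Algebra k L]

/-- The algebra map underlying the base change of an exponential map. -/
noncomputable def baseChangeHom (φ : ExpMap k A) : L ⊗[k] A →ₐ[L] (L ⊗[k] A)[X] :=
  Algebra.TensorProduct.lift (Algebra.ofId L _)
    ((Polynomial.mapAlgHom (Algebra.TensorProduct.includeRight : A →ₐ[k] L ⊗[k] A)).comp φ.toFun)
    fun _ _ => Commute.all _ _

theorem baseChangeHom_tmul (φ : ExpMap k A) (l : L) (a : A) :
    φ.baseChangeHom L (l ⊗ₜ a) = C (l ⊗ₜ 1) *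
      (φ.toFun a).map (Algebra.TensorProduct.includeRight : A →ₐ[k] L ⊗[k] A).toRingHom := by
  rw [baseChangeHom, Algebra.TensorProduct.lift_tmul]
  rfl

/-- The base change of an exponential map along a field extension. -/
noncomputable def baseChange (φ : ExpMap k A) : ExpMap L (L ⊗[k] A) where
  toFun := φ.baseChangeHom L
  eval_zero e := by
    induction e with
    | zero => simp
    | add e₁ e₂ h₁ h₂ => rw [map_add, eval_add, h₁, h₂]
    | tmul l a =>
      rw [baseChangeHom_tmul, eval_mul, eval_C, ← map_zero
        (Algebra.TensorProduct.includeRight : A →ₐ[k] L ⊗[k] A).toRingHom, eval_map_apply,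
        φ.eval_zero]
      simp
  coaction e := by
    induction e with
    | zero => simp
    | add e₁ e₂ h₁ h₂ => rw [map_add, Polynomial.map_add, eval₂_add, h₁, h₂]
    | tmul l a =>
      have h1 : ((φ.baseChangeHom L).toRingHom : L ⊗[k] A →+* (L ⊗[k] A)[X]).comp
          (Algebra.TensorProduct.includeRight : A →ₐ[k] L ⊗[k] A).toRingHom =
          (mapRingHom (Algebra.TensorProduct.includeRight : A →ₐ[k] L ⊗[k] A).toRingHom).comp
            φ.toFun.toRingHom := by
        ext1 b
        refine (baseChangeHom_tmul L φ 1 b).trans ?_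
        rw [← Algebra.TensorProduct.one_def, C_1, one_mul]
        rfl
      have h2 : (φ.baseChangeHom L).toRingHom (l ⊗ₜ 1) = C (l ⊗ₜ 1) := by
        refine (baseChangeHom_tmul L φ l 1).trans ?_
        rw [map_one, Polynomial.map_one, mul_one]
      rw [baseChangeHom_tmul, Polynomial.map_mul, map_C, Polynomial.map_map, h1, h2,
        ← Polynomial.map_map, φ.coaction, eval₂_mul, eval₂_C, eval₂_map, ← coe_mapRingHom,
        hom_eval₂]
      have h3 : (mapRingHom (mapRingHom
          (Algebra.TensorProduct.includeRight : A →ₐ[k] L ⊗[k] A).toRingHom)).comp (C.comp C) =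
          (C.comp C).comp (Algebra.TensorProduct.includeRight : A →ₐ[k] L ⊗[k] A).toRingHom := by
        ext1 b; simp
      rw [h3, map_add, coe_mapRingHom, map_X, map_C, coe_mapRingHom, map_X]
      rfl

theorem baseChange_D_tmul (φ : ExpMap k A) (n : ℕ) (l : L) (a : A) :
    (φ.baseChange L).D n (l ⊗ₜ a) = l ⊗ₜ φ.D n a := by
  rw [D_apply, D_apply]
  change (φ.baseChangeHom L (l ⊗ₜ a)).coeff n = _
  rw [baseChangeHom_tmul, coeff_C_mul, coeff_map]
  simp

end ExpMap

section Slice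

variable {L : Type*} [Field L] [Algebra k L]

/-- Contraction of `L ⊗ A` with a linear form on `L`. -/
noncomputable def tensorSlice (ℓ : L →ₗ[k] k) : L ⊗[k] A →ₗ[k] A :=
  (TensorProduct.lid k A).toLinearMap ∘ₗ LinearMap.rTensor A ℓ

@[simp] theorem tensorSlice_tmul (ℓ : L →ₗ[k] k) (l : L) (a : A) :
    tensorSlice ℓ (l ⊗ₜ a) = ℓ l • a := by
  simp [tensorSlice]

theorem tensorSlice_one_tmul_mul (ℓ : L →ₗ[k] k) (a : A) (e : L ⊗[k] A) :
    tensorSlice ℓ (1 ⊗ₜ a * e) = a * tensorSlice ℓ e := by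
  induction e with
  | zero => simp
  | add e₁ e₂ h₁ h₂ => rw [mul_add, map_add, map_add, h₁, h₂, mul_add]
  | tmul l b => simp

theorem tensorSlice_mem_induction (W : Submodule k A) (S : AddSubmonoid (L ⊗[k] A))
    (h : ∀ (l : L), ∀ w ∈ W, l ⊗ₜ w ∈ S) {e : L ⊗[k] A} (he : ∀ ℓ : L →ₗ[k] k, tensorSlice ℓ e ∈ W) :
    e ∈ S := by
  classical
  let b := Module.Basis.ofVectorSpace k L
  obtain ⟨c, rfl⟩ := TensorProduct.eq_repr_basis_left b e
  refine sum_mem fun i hi => h _ _ ?_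
  have h1 : ∀ j ∈ c.support, tensorSlice (b.coord i) (b j ⊗ₜ[k] c j) = if j = i then c i else 0 := by
    intro j _
    rw [tensorSlice_tmul, Module.Basis.coord_apply, Module.Basis.repr_self,
      Finsupp.single_apply]
    split_ifs with hj
    · rw [hj, one_smul]
    · rw [zero_smul]
  have h2 := he (b.coord i)
  rwa [Finsupp.sum, map_sum, Finset.sum_congr rfl h1, Finset.sum_ite_eq', if_pos hi] at h2

theorem eq_zero_of_tensorSlice_eq_zero {e : L ⊗[k] A} (he : ∀ ℓ : L →ₗ[k] k, tensorSlice ℓ e = 0) :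
    e = 0 := by
  have := tensorSlice_mem_induction (e := e) (⊥ : Submodule k A) (⊥ : AddSubmonoid (L ⊗[k] A))
    (by simp) (by simpa using he)
  simpa using this

variable (k L) in
theorem exists_linearForm_one : ∃ ℓ : L →ₗ[k] k, ℓ 1 = 1 := by
  obtain ⟨ℓ, hℓ⟩ := LinearMap.exists_leftInverse_of_injective (Algebra.linearMap k L)
    (LinearMap.ker_eq_bot.mpr (algebraMap k L).injective)
  exact ⟨ℓ, by simpa using LinearMap.congr_fun hℓ 1⟩

end Slice

namespace ExpMap

variable {L : Type*} [Field L] [Algebra k L] {φ : ExpMap k A}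

theorem tensorSlice_D (ℓ : L →ₗ[k] k) (n : ℕ) (e : L ⊗[k] A) :
    tensorSlice ℓ ((φ.baseChange L).D n e) = φ.D n (tensorSlice ℓ e) := by
  induction e with
  | zero => simp
  | add e₁ e₂ h₁ h₂ => rw [map_add, map_add, map_add, map_add, h₁, h₂]
  | tmul l b => rw [baseChange_D_tmul, tensorSlice_tmul, tensorSlice_tmul, map_smul]

theorem deg_tensorSlice_le (ℓ : L →ₗ[k] k) (e : L ⊗[k] A) :
    φ.deg (tensorSlice ℓ e) ≤ (φ.baseChange L).deg e := by
  rw [deg_le_iff]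
  intro m hm
  rw [← tensorSlice_D, D_eq_zero hm, map_zero]

theorem one_tmul_injective : Function.Injective (fun a : A => (1 : L) ⊗ₜ[k] a) :=
  Algebra.TensorProduct.includeRight_injective (algebraMap k L).injective

theorem baseChange_deg_one_tmul (a : A) : (φ.baseChange L).deg (1 ⊗ₜ a) = φ.deg a := by
  refine eq_of_forall_ge_iff fun n => ?_
  rw [deg_le_iff, deg_le_iff]
  refine forall₂_congr fun m _ => ?_
  rw [baseChange_D_tmul, ← tmul_zero A (1 : L)]
  exact one_tmul_injective.eq_iff

theorem mem_baseChange_invariants_iff {e : L ⊗[k] A} :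
    e ∈ (φ.baseChange L).invariants ↔ ∀ ℓ : L →ₗ[k] k, tensorSlice ℓ e ∈ φ.invariants := by
  simp only [mem_invariants_iff_D, ← tensorSlice_D]
  refine ⟨fun h ℓ n hn => by rw [h n hn, map_zero], fun h n hn =>
    eq_zero_of_tensorSlice_eq_zero fun ℓ => h ℓ n hn⟩

theorem IsMinDeg.baseChange {d : ℕ} (hd : φ.IsMinDeg d) : (φ.baseChange L).IsMinDeg d := by
  obtain ⟨h0, ⟨x, hx⟩, h⟩ := hd
  refine ⟨h0, ⟨1 ⊗ₜ x, by rw [baseChange_deg_one_tmul, hx]⟩, fun e he => ?_⟩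
  rw [← mem_invariants_iff_deg, mem_baseChange_invariants_iff]
  intro ℓ
  rw [mem_invariants_iff_deg]
  exact h _ ((deg_tensorSlice_le ℓ e).trans_lt he)

end ExpMap

end BaseChange

/-! ### Structure of forms with a nontrivial exponential map -/

section Structure

open Polynomial TensorProduct

/-- Two injective algebra homomorphisms with the same range have isomorphic sources. -/
noncomputable def AlgEquiv.ofRangeEq {R S T U : Type*} [CommSemiring R] [Semiring S] [Semiring T]
    [Semiring U] [Algebra R S] [Algebra R T] [Algebra R U] (f : S →ₐ[R] U) (g : T →ₐ[R] U)
    (hf : Function.Injective f) (hg : Function.Injective g) (h : f.range = g.range) : S ≃ₐ[R] T :=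
  ((AlgEquiv.ofInjective f hf).trans (Subalgebra.equivOfEq _ _ h)).trans
    (AlgEquiv.ofInjective g hg).symm

namespace ExpMap

variable {L : Type*} [Field L] [Algebra k L] {φ : ExpMap k A}

theorem range_tensor_val_eq (φ : ExpMap k A) :
    (Algebra.TensorProduct.map (AlgHom.id L L) φ.invariants.val).range =
      (φ.baseChange L).invariants := by
  apply le_antisymm
  · rintro _ ⟨e, rfl⟩
    induction e with
    | zero => simp
    | add e₁ e₂ h₁ h₂ => rw [map_add]; exact add_mem h₁ h₂
    | tmul l c =>
      change l ⊗ₜ[k] (c : A) ∈ _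
      rw [mem_baseChange_invariants_iff]
      intro ℓ
      rw [tensorSlice_tmul]
      exact Subalgebra.smul_mem _ c.2 _
  · intro e he
    rw [mem_baseChange_invariants_iff] at he
    refine tensorSlice_mem_induction (Subalgebra.toSubmodule φ.invariants)
      (Algebra.TensorProduct.map (AlgHom.id L L) φ.invariants.val).range.toAddSubmonoid ?_ he
    intro l w hw
    exact ⟨l ⊗ₜ ⟨w, hw⟩, rfl⟩

theorem tensor_val_injective (C : Subalgebra k A) :
    Function.Injective (Algebra.TensorProduct.map (AlgHom.id L L) C.val) := by
  exact Module.Flat.lTensor_preserves_injective_linearMap C.val.toLinearMap Subtype.val_injective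

theorem isDomain_of_tensor [IsDomain (L ⊗[k] A)] : IsDomain A :=
  Function.Injective.isDomain (Algebra.TensorProduct.includeRight : A →ₐ[k] L ⊗[k] A).toRingHom
    one_tmul_injective

theorem nonempty_polynomial_algEquiv_tensor_invariants [IsAlgClosed L]
    (σ : (L ⊗[k] A)[X] ≃ₐ[L] MvPolynomial (Fin 3) L) (hφ : φ.Nontrivial) :
    Nonempty (L ⊗[k] φ.invariants ≃ₐ[L] L[X]) := by
  have := isDomain_of_cylinder σ
  obtain ⟨d, hd⟩ := hφ.exists_isMinDeg
  have hφ' : (φ.baseChange L).Nontrivial := by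
    obtain ⟨x, hx⟩ := hd.baseChange (L := L).2.1
    exact ⟨x, fun h => hd.1.ne' (hx ▸ mem_invariants_iff_deg.mp h)⟩
  obtain ⟨g, hg, hg0⟩ := exists_mem_invariants_cylDeg_ne_zero σ (hd.baseChange (L := L))
  obtain ⟨f, hfC, hf0, hprime, hgen⟩ := exists_generator_invariants σ hg hg0 hφ'
  refine ⟨AlgEquiv.ofRangeEq (Algebra.TensorProduct.map (AlgHom.id L L) φ.invariants.val)
    (aeval f) (tensor_val_injective _)
    (aeval_injective_of_sub_algebraMap_ne_zero fun l => (hprime l).ne_zero) ?_⟩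
  rw [range_tensor_val_eq]
  apply le_antisymm
  · intro c hc
    obtain ⟨P, hP⟩ := hgen c hc
    exact ⟨P, hP.symm⟩
  · rw [← Algebra.adjoin_singleton_eq_range_aeval]
    exact Algebra.adjoin_le (by simpa using hfC)

/-- The ideal of the invariant ring formed by the `d`-th coefficients of the elements of degree at
most `d`. -/
noncomputable def leadingIdeal (φ : ExpMap k A) (d : ℕ) : Ideal φ.invariants where
  carrier := {c | ∃ a, φ.deg a ≤ d ∧ φ.D d a = c}
  zero_mem' := ⟨0, by simp [deg], by simp⟩
  add_mem' := by
    rintro _ _ ⟨a, ha, ha'⟩ ⟨b, hb, hb'⟩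
    exact ⟨a + b, deg_add_le ha hb, by rw [map_add, ha', hb']; rfl⟩
  smul_mem' := by
    rintro q _ ⟨a, ha, ha'⟩
    exact ⟨q * a, deg_mul_le_of_mem q.2 ha, by rw [D_mul_of_mem q.2, ha']; rfl⟩

theorem exists_D_eq_mul_D {d : ℕ} (hd0 : 0 < d) [IsDomain A] {s : A} (hs : φ.deg s = d)
    (hgen : ∀ a, ∃ P : φ.invariants[X], a = aeval s P) {a : A} (ha : φ.deg a ≤ d) :
    ∃ e ∈ φ.invariants, φ.D d a = e * φ.D d s := by
  obtain ⟨P, rfl⟩ := hgen a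
  rw [deg_aeval, hs] at ha
  have hP : P.natDegree ≤ 1 := by
    by_contra h
    have : 2 * d ≤ P.natDegree * d := Nat.mul_le_mul_right d (by omega)
    omega
  refine ⟨P.coeff 1, (P.coeff 1).2, ?_⟩
  rw [eq_X_add_C_of_natDegree_le_one hP, map_add, map_mul, aeval_C, aeval_X, aeval_C, map_add]
  change φ.D d ((P.coeff 1 : A) * s) + φ.D d (P.coeff 0 : A) = _
  rw [D_mul_of_mem (P.coeff 1).2, mem_invariants_iff_D.mp (P.coeff 0).2 d hd0, add_zero]
  simp

/-- The leading coefficient of a relative generator over `L` makes the leading ideal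
invertible. -/
theorem exists_forall_mul_eq_mul [IsDomain (L ⊗[k] A)] {d : ℕ} (hd : φ.IsMinDeg d) {s : L ⊗[k] A}
    (hs : (φ.baseChange L).deg s = d)
    (hgen : ∀ e, ∃ P : (φ.baseChange L).invariants[X], e = aeval s P) :
    ∃ c ∈ φ.invariants, c ≠ 0 ∧ ∃ y, φ.deg y ≤ d ∧ φ.D d y = c ∧
      ∀ j ∈ φ.leadingIdeal d, ∃ a, (j : A) * y = c * a := by
  have := isDomain_of_tensor (k := k) (A := A) (L := L)
  obtain ⟨x, hx⟩ := hd.2.1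
  have hx0 : x ≠ 0 := by
    rintro rfl
    exact hd.1.ne' (by rw [← hx]; simp [deg])
  have hcC : φ.D d x ∈ φ.invariants := hx ▸ φ.D_deg_mem x
  refine ⟨φ.D d x, hcC, hx ▸ D_deg_ne_zero hx0, ?_⟩
  set c := φ.D d x with hc
  have hc0 : c ≠ 0 := by rw [hc]; exact hx ▸ D_deg_ne_zero hx0
  set γ := (φ.baseChange L).D d s with hγ
  obtain ⟨γ', hγ', hcγ⟩ := exists_D_eq_mul_D hd.1 hs hgen (a := 1 ⊗ₜ x)
    (by rw [baseChange_deg_one_tmul, hx])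
  rw [baseChange_D_tmul, ← hc, ← hγ] at hcγ
  let J : Submodule k A :=
    { carrier := {j | ∃ a, φ.deg a ≤ d ∧ φ.D d a = j}
      zero_mem' := ⟨0, by simp [deg], by simp⟩
      add_mem' := by
        rintro _ _ ⟨a, ha, ha'⟩ ⟨b, hb, hb'⟩
        exact ⟨a + b, deg_add_le ha hb, by rw [map_add, ha', hb']⟩
      smul_mem' := by
        rintro m _ ⟨a, ha, ha'⟩
        refine ⟨m • a, ?_, by rw [map_smul, ha']⟩
        rw [deg_le_iff] at ha ⊢
        intro n hn
        rw [map_smul, ha n hn, smul_zero] }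
  have hJ : ∀ j, j ∈ J ↔ ∃ a, φ.deg a ≤ d ∧ φ.D d a = j := fun _ => Iff.rfl
  let Q : Submodule k A :=
    { carrier := {q | q ∈ φ.invariants ∧ ∀ j ∈ J, ∃ r ∈ φ.invariants, q * j = c * r}
      zero_mem' := ⟨zero_mem _, fun j _ => ⟨0, zero_mem _, by ring⟩⟩
      add_mem' := by
        rintro p q ⟨hp, hp'⟩ ⟨hq, hq'⟩
        refine ⟨add_mem hp hq, fun j hj => ?_⟩
        obtain ⟨r, hr, h⟩ := hp' j hj
        obtain ⟨r', hr', h'⟩ := hq' j hj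
        exact ⟨r + r', add_mem hr hr', by linear_combination h + h'⟩
      smul_mem' := by
        rintro m q ⟨hq, hq'⟩
        refine ⟨Subalgebra.smul_mem _ hq m, fun j hj => ?_⟩
        obtain ⟨r', hr', h'⟩ := hq' j hj
        exact ⟨m • r', Subalgebra.smul_mem _ hr' m, by
          rw [smul_mul_assoc, h', mul_smul_comm]⟩ }
  have hγJ : ∀ ℓ : L →ₗ[k] k, tensorSlice ℓ γ ∈ J := fun ℓ =>
    (hJ _).mpr ⟨tensorSlice ℓ s, (deg_tensorSlice_le ℓ s).trans hs.le, (tensorSlice_D ℓ d s).symm⟩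
  have hγQ : ∀ ℓ : L →ₗ[k] k, tensorSlice ℓ γ' ∈ Q := by
    intro ℓ
    refine ⟨mem_baseChange_invariants_iff.mp hγ' ℓ, fun j hj => ?_⟩
    obtain ⟨a, ha, rfl⟩ := (hJ j).mp hj
    obtain ⟨e, he, hje⟩ := exists_D_eq_mul_D hd.1 hs hgen (a := 1 ⊗ₜ a)
      (by rwa [baseChange_deg_one_tmul])
    rw [baseChange_D_tmul, ← hγ] at hje
    refine ⟨tensorSlice ℓ e, mem_baseChange_invariants_iff.mp he ℓ, ?_⟩
    rw [← tensorSlice_one_tmul_mul, hcγ, mul_comm, ← tensorSlice_one_tmul_mul, hje]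
    congr 1
    ring
  obtain ⟨ℓ, hℓ⟩ := exists_linearForm_one k L
  have hcJQ : c ∈ J * Q := by
    let S : AddSubmonoid (L ⊗[k] A) := ((J * Q).comap (tensorSlice ℓ)).toAddSubmonoid
    have h1 : ∀ (l : L), ∀ q ∈ Q, γ * l ⊗ₜ q ∈ S := by
      intro l q hq
      refine tensorSlice_mem_induction J (S.comap (AddMonoidHom.mulRight (l ⊗ₜ q))) ?_ hγJ
      intro m j hj
      change tensorSlice ℓ ((m ⊗ₜ j) * (l ⊗ₜ q)) ∈ J * Q
      rw [Algebra.TensorProduct.tmul_mul_tmul, tensorSlice_tmul]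
      exact Submodule.smul_mem _ _ (Submodule.mul_mem_mul hj hq)
    have h2 : γ * γ' ∈ S :=
      tensorSlice_mem_induction Q (S.comap (AddMonoidHom.mulLeft γ)) h1 hγQ
    rw [mul_comm, ← hcγ] at h2
    change tensorSlice ℓ _ ∈ J * Q at h2
    rwa [tensorSlice_tmul, hℓ, one_smul] at h2
  have key : ∀ m ∈ J * Q, ∃ y, φ.deg y ≤ d ∧ φ.D d y = m ∧ ∀ j ∈ J, ∃ a, j * y = c * a := by
    intro m hm
    induction hm using Submodule.mul_induction_on' with
    | mem_mul_mem j hj q hq =>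
      obtain ⟨a, ha, rfl⟩ := (hJ j).mp hj
      refine ⟨q * a, deg_mul_le_of_mem hq.1 ha, by rw [D_mul_of_mem hq.1, mul_comm],
        fun j hj => ?_⟩
      obtain ⟨r, -, hr⟩ := hq.2 j hj
      exact ⟨r * a, by linear_combination a * hr⟩
    | add m _ m' _ h h' =>
      obtain ⟨y, hy, hy', h⟩ := h
      obtain ⟨z, hz, hz', h'⟩ := h'
      refine ⟨y + z, deg_add_le hy hz, by rw [map_add, hy', hz'], fun j hj => ?_⟩
      obtain ⟨a, ha⟩ := h j hj
      obtain ⟨b, hb⟩ := h' j hj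
      exact ⟨a + b, by linear_combination ha + hb⟩
  obtain ⟨y, hy, hy', h⟩ := key c hcJQ
  exact ⟨y, hy, hy', fun j hj => h j ((hJ j).mpr hj)⟩

theorem deg_eq_and_D_eq_of_mul_eq [IsDomain A] {d : ℕ} {c : A} (hc : c ∈ φ.invariants) (hc0 : c ≠ 0)
    {y : A} (hy : φ.deg y ≤ d) (hyc : φ.D d y = c) {j : A} (hj : j ∈ φ.invariants) {a : A}
    (h : j * y = c * a) : φ.deg a ≤ d ∧ φ.D d a = j := by
  constructor
  · rw [deg_le_iff] at hy ⊢
    intro m hm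
    have := congrArg (φ.D m) h
    rw [D_mul_of_mem hj, D_mul_of_mem hc, hy m hm, mul_zero] at this
    exact (mul_eq_zero.mp this.symm).resolve_left hc0
  · have := congrArg (φ.D d) h
    rw [D_mul_of_mem hj, D_mul_of_mem hc, hyc, mul_comm] at this
    exact (mul_left_cancel₀ hc0 this).symm

/-- A subalgebra containing the invariants, and a lift of each element of the leading ideal, is
everything. -/
theorem eq_top_of_forall_leadingIdeal [IsDomain (L ⊗[k] A)] {d : ℕ} (hd : φ.IsMinDeg d)
    {s : L ⊗[k] A} (hs : (φ.baseChange L).deg s = d)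
    (hgen : ∀ e, ∃ P : (φ.baseChange L).invariants[X], e = aeval s P) (R : Subalgebra k A)
    (hR : φ.invariants ≤ R)
    (hJ : ∀ j ∈ φ.leadingIdeal d, ∃ a ∈ R, φ.deg a ≤ d ∧ φ.D d a = j) : R = ⊤ := by
  let RL := (Algebra.TensorProduct.map (AlgHom.id L L) R.val).range
  have hRL : ∀ (l : L), ∀ a ∈ R, l ⊗ₜ[k] a ∈ RL := fun l a ha => ⟨l ⊗ₜ ⟨a, ha⟩, rfl⟩
  have hinv : (φ.baseChange L).invariants ≤ RL := by
    rw [← range_tensor_val_eq]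
    rintro _ ⟨e, rfl⟩
    induction e with
    | zero => simp
    | add e₁ e₂ h₁ h₂ => rw [map_add]; exact add_mem h₁ h₂
    | tmul l c => exact hRL l c (hR c.2)
  have hlift : ∀ l : L, ∀ j ∈ φ.leadingIdeal d, ∃ e ∈ RL, (φ.baseChange L).deg e ≤ d ∧
      (φ.baseChange L).D d e = l ⊗ₜ (j : A) := by
    intro l j hj
    obtain ⟨a, haR, ha, haj⟩ := hJ j hj
    refine ⟨l ⊗ₜ a, hRL l a haR, ?_, by rw [baseChange_D_tmul, haj]⟩
    rw [deg_le_iff] at ha ⊢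
    intro m hm
    rw [baseChange_D_tmul, ha m hm, tmul_zero]
  obtain ⟨s₀, hs₀, hs₀d, hs₀D⟩ : ∃ e ∈ RL, (φ.baseChange L).deg e ≤ d ∧
      (φ.baseChange L).D d e = (φ.baseChange L).D d s := by
    let S : AddSubmonoid (L ⊗[k] A) :=
      { carrier := {γ | ∃ e ∈ RL, (φ.baseChange L).deg e ≤ d ∧ (φ.baseChange L).D d e = γ}
        zero_mem' := ⟨0, zero_mem _, by simp [deg], by simp⟩
        add_mem' := by
          rintro _ _ ⟨a, haR, ha, ha'⟩ ⟨b, hbR, hb, hb'⟩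
          exact ⟨a + b, add_mem haR hbR, deg_add_le ha hb, by rw [map_add, ha', hb']⟩ }
    let J : Submodule k A :=
      ((φ.leadingIdeal d).restrictScalars k).map (Subalgebra.toSubmodule φ.invariants).subtype
    refine tensorSlice_mem_induction J S ?_ fun ℓ => ?_
    · rintro l _ ⟨j, hj, rfl⟩
      exact hlift l j hj
    · have h1 : φ.deg (tensorSlice ℓ s) ≤ d := (deg_tensorSlice_le ℓ s).trans hs.le
      rw [tensorSlice_D]
      exact ⟨⟨_, D_mem_of_deg_le h1⟩, ⟨_, h1, rfl⟩, rfl⟩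
  have hsR : s ∈ RL := by
    have h1 : s - s₀ ∈ (φ.baseChange L).invariants := by
      apply (hd.baseChange (L := L)).mem_of_lt
      have h2 : (φ.baseChange L).deg (s - s₀) ≤ d := by
        rw [deg_le_iff] at hs₀d ⊢
        intro m hm
        rw [map_sub, hs₀d m hm, D_eq_zero (hs.trans_lt hm), sub_zero]
      refine lt_of_le_of_ne h2 fun h => ?_
      have h3 : (φ.baseChange L).D d (s - s₀) = 0 := by rw [map_sub, hs₀D, sub_self]
      by_cases h0 : s - s₀ = 0
      · rw [h0] at h
        exact hd.1.ne' (by rw [← h]; simp [deg])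
      · exact D_deg_ne_zero h0 (h ▸ h3)
    exact (sub_add_cancel s s₀) ▸ add_mem (hinv h1) hs₀
  have htop : ∀ e, e ∈ RL := by
    intro e
    obtain ⟨P, rfl⟩ := hgen e
    rw [aeval_eq_sum_range]
    exact sum_mem fun i _ => by
      rw [Algebra.smul_def]
      exact mul_mem (hinv (P.coeff i).2) (pow_mem hsR i)
  obtain ⟨ℓ, hℓ⟩ := exists_linearForm_one k L
  have hsl : ∀ e ∈ RL, tensorSlice ℓ e ∈ R := by
    rintro _ ⟨e, rfl⟩
    induction e with
    | zero => simp
    | add e₁ e₂ h₁ h₂ => rw [map_add, map_add]; exact add_mem h₁ h₂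
    | tmul l a =>
      change tensorSlice ℓ (l ⊗ₜ[k] (a : A)) ∈ R
      rw [tensorSlice_tmul]
      exact Subalgebra.smul_mem _ a.2 _
  refine eq_top_iff.mpr fun a _ => ?_
  have := hsl _ (htop (1 ⊗ₜ a))
  rwa [tensorSlice_tmul, hℓ, one_smul] at this

theorem exists_algEquiv_reesAlgebra [IsAlgClosed L]
    (σ : (L ⊗[k] A)[X] ≃ₐ[L] MvPolynomial (Fin 3) L) (hφ : φ.Nontrivial) :
    ∃ J : Ideal φ.invariants, J ≠ ⊥ ∧ Nonempty (A ≃ₐ[φ.invariants] reesAlgebra J) := by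
  have := isDomain_of_cylinder σ
  have := isDomain_of_tensor (k := k) (A := A) (L := L)
  obtain ⟨d, hd⟩ := hφ.exists_isMinDeg
  have hφ' : (φ.baseChange L).Nontrivial := by
    obtain ⟨x, hx⟩ := hd.baseChange (L := L).2.1
    exact ⟨x, fun h => hd.1.ne' (hx ▸ mem_invariants_iff_deg.mp h)⟩
  obtain ⟨g, hg, hg0⟩ := exists_mem_invariants_cylDeg_ne_zero σ (hd.baseChange (L := L))
  obtain ⟨f, hfC, hf0, hprime, hgenC⟩ := exists_generator_invariants σ hg hg0 hφ'
  obtain ⟨s, hs, hgen⟩ :=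
    (hd.baseChange (L := L)).exists_forall_eq_aeval σ hfC hf0 hprime hgenC
  obtain ⟨c, hc, hc0, y, hy, hyc, hyJ⟩ := exists_forall_mul_eq_mul hd hs hgen
  refine ⟨φ.leadingIdeal d, ?_, ?_⟩
  · intro h
    have h1 : (⟨c, hc⟩ : φ.invariants) ∈ φ.leadingIdeal d := ⟨y, hy, hyc⟩
    rw [h] at h1
    exact hc0 (congrArg Subtype.val h1)
  let K := FractionRing A
  let ι : A →ₐ[φ.invariants] K := IsScalarTower.toAlgHom _ _ _
  have hι : Function.Injective ι := IsFractionRing.injective A K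
  have hc0' : ι c ≠ 0 := (map_ne_zero_iff ι hι).mpr hc0
  let h : φ.invariants[X] →ₐ[φ.invariants] K := aeval (ι y / ι c)
  have hyd : φ.deg y = d := by
    refine hy.antisymm (not_lt.mp fun hlt => hc0 ?_)
    rw [← hyc, φ.D_eq_zero hlt]
  have hh : Function.Injective h := by
    refine (injective_iff_map_eq_zero h).mpr fun P hP => ?_
    have h1 := scaleRoots_eval₂_mul (algebraMap φ.invariants K) (ι y / ι c) ⟨c, hc⟩ (p := P)
    rw [show algebraMap φ.invariants K ⟨c, hc⟩ = ι c from rfl, mul_div_cancel₀ _ hc0',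
      show eval₂ (algebraMap φ.invariants K) (ι y / ι c) P = 0 from hP, mul_zero] at h1
    have h2 : aeval y (P.scaleRoots ⟨c, hc⟩) = 0 := by
      refine hι ?_
      rw [map_zero, ← aeval_algHom_apply]
      exact h1
    have h3 := φ.deg_aeval (P.scaleRoots ⟨c, hc⟩) y
    rw [h2, hyd, mem_invariants_iff_deg.mp φ.invariants.zero_mem, eq_comm,
      Nat.mul_eq_zero, or_iff_left hd.1.ne'] at h3
    rw [eq_C_of_natDegree_eq_zero h3, aeval_C] at h2
    by_contra hP0
    refine scaleRoots_ne_zero hP0 ⟨c, hc⟩ ?_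
    have h4 : (P.scaleRoots ⟨c, hc⟩).coeff 0 = 0 := Subtype.val_injective h2
    rw [eq_C_of_natDegree_eq_zero h3, h4]
    exact C_0
  have hmon : ∀ j ∈ φ.leadingIdeal d, ∀ a, (j : A) * y = c * a → h (monomial 1 j) = ι a := by
    intro j _ a ha
    have h1 := congrArg ι ha
    rw [map_mul, map_mul] at h1
    rw [aeval_monomial, pow_one, mul_div_assoc', div_eq_iff hc0', mul_comm (ι a), ← h1]
    rfl
  refine ⟨AlgEquiv.ofRangeEq ι (h.comp (reesAlgebra (φ.leadingIdeal d)).val) hι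
    (hh.comp Subtype.val_injective) (le_antisymm ?_ ?_)⟩
  · let R : Subalgebra φ.invariants A :=
      (h.comp (reesAlgebra (φ.leadingIdeal d)).val).range.comap ι
    have hR : R.restrictScalars k = ⊤ := by
      refine eq_top_of_forall_leadingIdeal hd hs hgen _ ?_ ?_
      · intro c hc
        exact R.algebraMap_mem ⟨c, hc⟩
      · intro j hj
        obtain ⟨a, ha⟩ := hyJ j hj
        refine ⟨a, ⟨⟨monomial 1 j, ?_⟩, hmon j hj a ha⟩,
          deg_eq_and_D_eq_of_mul_eq hc hc0 hy hyc j.2 ha⟩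
        exact reesAlgebra.monomial_mem.mpr (by rwa [pow_one])
    rintro _ ⟨a, rfl⟩
    have : a ∈ R.restrictScalars k := hR ▸ Algebra.mem_top
    exact this
  · rintro _ ⟨⟨P, hP⟩, rfl⟩
    change h P ∈ _
    rw [← adjoin_monomial_eq_reesAlgebra] at hP
    have : Algebra.adjoin φ.invariants (Submodule.map (monomial 1) (φ.leadingIdeal d) :
      Set φ.invariants[X]) ≤ ι.range.comap h := by
      refine Algebra.adjoin_le ?_
      rintro _ ⟨j, hj, rfl⟩
      obtain ⟨a, ha⟩ := hyJ j hj
      exact ⟨a, (hmon j hj a ha).symm⟩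
    exact this hP

end ExpMap

end Structure

section Homogenization

open Polynomial

section Top

variable {R : Type*} [CommRing R]

/-- Bivariate polynomials `g(T, U)` such that the coefficient of `U ^ i` has degree at most
`N + p * i` in `T`. -/
def HasWeightLE (p N : ℕ) (g : R[X][X]) : Prop := ∀ i, (g.coeff i).natDegree ≤ N + p * i

/-- The component of extreme weight of a bivariate polynomial satisfying `HasWeightLE p N`. -/
noncomputable def topWeight (p N : ℕ) (g : R[X][X]) : R[X] :=
  ∑ i ∈ g.support, monomial i ((g.coeff i).coeff (N + p * i))

@[simp] theorem coeff_topWeight (p N : ℕ) (g : R[X][X]) (i : ℕ) :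
    (topWeight p N g).coeff i = (g.coeff i).coeff (N + p * i) := by
  simp only [topWeight, finsetSum_coeff, coeff_monomial]
  rw [Finset.sum_ite_eq']
  split_ifs with h
  · rfl
  · rw [notMem_support_iff.mp h, coeff_zero]

@[simp] theorem topWeight_zero (p N : ℕ) : topWeight p N (0 : R[X][X]) = 0 := by
  ext i; simp

theorem topWeight_add (p N : ℕ) (g h : R[X][X]) :
    topWeight p N (g + h) = topWeight p N g + topWeight p N h := by
  ext i; simp

variable {p : ℕ}

theorem HasWeightLE.mono {M N : ℕ} {g : R[X][X]} (hg : HasWeightLE p M g) (h : M ≤ N) :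
    HasWeightLE p N g := fun i => (hg i).trans (by gcongr)

theorem HasWeightLE.topWeight_eq_zero {M N : ℕ} {g : R[X][X]} (hg : HasWeightLE p M g)
    (h : M < N) : topWeight p N g = 0 := by
  ext i
  rw [coeff_topWeight, coeff_zero, coeff_eq_zero_of_natDegree_lt]
  exact (hg i).trans_lt (by gcongr)

theorem HasWeightLE.add {N : ℕ} {g h : R[X][X]} (hg : HasWeightLE p N g)
    (hh : HasWeightLE p N h) : HasWeightLE p N (g + h) := fun i => by
  rw [coeff_add]
  exact natDegree_add_le_of_degree_le (hg i) (hh i)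

theorem HasWeightLE.mul {M N : ℕ} {g h : R[X][X]} (hg : HasWeightLE p M g)
    (hh : HasWeightLE p N h) : HasWeightLE p (M + N) (g * h) := fun n => by
  rw [coeff_mul]
  refine natDegree_sum_le_of_forall_le _ _ fun x hx => ?_
  rw [Finset.HasAntidiagonal.mem_antidiagonal] at hx
  refine (natDegree_mul_le_of_le (hg x.1) (hh x.2)).trans (le_of_eq ?_)
  rw [← hx]; ring

theorem HasWeightLE.topWeight_mul {M N : ℕ} {g h : R[X][X]} (hg : HasWeightLE p M g)
    (hh : HasWeightLE p N h) :
    topWeight p (M + N) (g * h) = topWeight p M g * topWeight p N h := by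
  ext n
  rw [coeff_topWeight, coeff_mul, coeff_mul, finsetSum_coeff]
  refine Finset.sum_congr rfl fun x hx => ?_
  rw [Finset.HasAntidiagonal.mem_antidiagonal] at hx
  rw [coeff_topWeight, coeff_topWeight, ← coeff_mul_add_eq_of_natDegree_le (hg x.1) (hh x.2)]
  congr 1
  rw [← hx]; ring

theorem HasWeightLE.C_C (r : R) : HasWeightLE p 0 (C (C r)) := fun i => by
  rw [coeff_C]
  split_ifs <;> simp

theorem topWeight_C_C (r : R) : topWeight p 0 (C (C r)) = C r := by
  ext i
  rw [coeff_topWeight, coeff_C, coeff_C]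
  split_ifs with h <;> simp [h]

theorem HasWeightLE.pow {N : ℕ} {g : R[X][X]} (hg : HasWeightLE p N g) (m : ℕ) :
    HasWeightLE p (N * m) (g ^ m) ∧ topWeight p (N * m) (g ^ m) = topWeight p N g ^ m := by
  induction m with
  | zero =>
    rw [mul_zero, pow_zero, pow_zero, ← C_1, ← C_1]
    exact ⟨HasWeightLE.C_C 1, topWeight_C_C 1⟩
  | succ m ih =>
    rw [mul_add_one, pow_succ, pow_succ, ← ih.2]
    exact ⟨ih.1.mul hg, ih.1.topWeight_mul hg⟩

end Top

namespace ExpMap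

variable (ψ : ExpMap k A[X]) {p q : ℕ}

/-- The map `ψ`, with the polynomial variable `X` rescaled to have weight `q`. -/
noncomputable def expandHom (q : ℕ) : A[X] →+* A[X][X] :=
  (mapRingHom (expand A q : A[X] →+* A[X])).comp ψ.toFun.toRingHom

theorem coeff_expandHom (q : ℕ) (f : A[X]) (i : ℕ) :
    (ψ.expandHom q f).coeff i = expand A q (ψ.D i f) := by
  rw [expandHom, RingHom.comp_apply, coe_mapRingHom, coeff_map]
  rfl

variable {ψ}

theorem hasWeightLE_expandHom (hC : ∀ a, HasWeightLE p 0 (ψ.expandHom q (C a)))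
    (hX : HasWeightLE p q (ψ.expandHom q X)) {n : ℕ} {f : A[X]} (hf : f.natDegree ≤ n) :
    HasWeightLE p (q * n) (ψ.expandHom q f) := by
  refine induction_with_natDegree_le (fun f => HasWeightLE p (q * n) (ψ.expandHom q f)) n
    ?_ ?_ ?_ f hf
  · intro i
    simp
  · intro m r _ hm
    rw [map_mul, map_pow]
    refine ((hC r).mul (hX.pow m).1).mono ?_
    rw [zero_add]
    gcongr
  · intro f g _ _ hf hg
    rw [map_add]
    exact hf.add hg

theorem topWeight_expandHom (hq : 0 < q) (hC : ∀ a, HasWeightLE p 0 (ψ.expandHom q (C a)))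
    (hX : HasWeightLE p q (ψ.expandHom q X)) {n : ℕ} {f : A[X]} (hf : f.natDegree ≤ n) :
    topWeight p (q * n) (ψ.expandHom q f) =
      topWeight p 0 (ψ.expandHom q (C (f.coeff n))) * topWeight p q (ψ.expandHom q X) ^ n := by
  refine induction_with_natDegree_le (fun f => topWeight p (q * n) (ψ.expandHom q f) =
    topWeight p 0 (ψ.expandHom q (C (f.coeff n))) * topWeight p q (ψ.expandHom q X) ^ n) n
    ?_ ?_ ?_ f hf
  · ext i
    simp
  · intro m r _ hm
    rcases hm.lt_or_eq with hm | rfl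
    · rw [coeff_C_mul_X_pow, if_neg hm.ne', C_0, map_zero,
        (hasWeightLE_expandHom hC hX (natDegree_C_mul_X_pow_le r m)).topWeight_eq_zero
          (Nat.mul_lt_mul_of_pos_left hm hq)]
      ext i
      simp
    · rw [map_mul, map_pow, coeff_C_mul_X_pow, if_pos rfl, ← (hX.pow m).2,
        ← (hC r).topWeight_mul (hX.pow m).1, zero_add]
  · intro f g _ _ hf hg
    rw [map_add, topWeight_add, hf, hg, coeff_add, C_add, map_add, topWeight_add, add_mul]

theorem topWeight_expandHom_D (f : A[X]) (N i j : ℕ) :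
    (topWeight p (N + p * i) (ψ.expandHom q (ψ.D i f))).coeff j =
      ((i + j).choose i : A) * (topWeight p N (ψ.expandHom q f)).coeff (i + j) := by
  rw [coeff_topWeight, coeff_topWeight, coeff_expandHom, coeff_expandHom, D_D, map_mul,
    map_natCast, ← C_eq_natCast, coeff_C_mul, mul_add, add_assoc]

theorem topWeight_expandHom_X [IsDomain A] (hq : 0 < q)
    (hC : ∀ a, HasWeightLE p 0 (ψ.expandHom q (C a)))
    (hX : HasWeightLE p q (ψ.expandHom q X)) : topWeight p q (ψ.expandHom q X) = 1 := by
  set τ := topWeight p q (ψ.expandHom q X) with hτ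
  have h0 : τ.coeff 0 = 1 := by
    rw [hτ, coeff_topWeight, coeff_expandHom, D_zero, expand_X, mul_zero, add_zero, coeff_X_pow,
      if_pos rfl]
  suffices h : τ.natDegree = 0 by rw [eq_C_of_natDegree_eq_zero h, h0, C_1]
  by_contra hN
  have hτ0 : τ ≠ 0 := fun h => hN (by rw [h, natDegree_zero])
  have ht : τ.coeff τ.natDegree ≠ 0 := leadingCoeff_ne_zero.mpr hτ0
  set N := τ.natDegree with hNdef
  have hN' := ht
  rw [hτ, coeff_topWeight, coeff_expandHom, coeff_expand hq] at hN'
  split_ifs at hN' with hdvd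
  swap
  · exact hN' rfl
  obtain ⟨m, hm⟩ := hdvd
  have hdeg : (ψ.D N X).natDegree ≤ m := by
    have := hX N
    rw [coeff_expandHom, natDegree_expand, hm, mul_comm] at this
    exact Nat.le_of_mul_le_mul_left this hq
  rw [hm, Nat.mul_div_cancel_left _ hq] at hN'
  have h1 := topWeight_expandHom hq hC hX hdeg
  have h2 : (topWeight p (q * m) (ψ.expandHom q (ψ.D N X))).natDegree = 0 := by
    rw [← Nat.le_zero, natDegree_le_iff_coeff_eq_zero]
    intro j hj
    rw [← hm, topWeight_expandHom_D, ← hτ, coeff_eq_zero_of_natDegree_lt, mul_zero]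
    omega
  have h3 : topWeight p 0 (ψ.expandHom q (C ((ψ.D N X).coeff m))) ≠ 0 := by
    intro h
    have := congrArg (fun P => P.coeff 0) h
    simp only [coeff_topWeight, coeff_expandHom, D_zero, expand_C, coeff_C, coeff_zero] at this
    exact hN' (by simpa using this)
  rw [h1, natDegree_mul h3 (pow_ne_zero _ hτ0), natDegree_pow, ← hNdef] at h2
  have h4 : m ≠ 0 := by
    rintro rfl
    omega
  have h5 : m * N = 0 := by omega
  rcases Nat.mul_eq_zero.mp h5 with h | h
  · exact h4 h
  · exact hN h

/-- The extreme weight part of an exponential map on `A[X]`, restricted to `A`. -/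
noncomputable def extremeHom (hC : ∀ a, HasWeightLE p 0 (ψ.expandHom q (C a))) : A →ₐ[k] A[X] where
  toFun a := topWeight p 0 (ψ.expandHom q (C a))
  map_one' := by rw [C_1, map_one, ← C_1, ← C_1, topWeight_C_C]
  map_zero' := by ext; simp
  map_add' a b := by rw [C_add, map_add, topWeight_add]
  map_mul' a b := by rw [C_mul, map_mul, ← (hC a).topWeight_mul (hC b)]
  commutes' r := by
    ext i
    have h : ψ.toFun (C (algebraMap k A r)) = C (C (algebraMap k A r)) := ψ.toFun.commutes r
    rw [coeff_topWeight, coeff_expandHom, D_apply, h, coeff_C, Polynomial.algebraMap_apply, coeff_C]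
    split_ifs with hi
    · rw [hi]
      simp
    · simp

/-- The exponential map on `A` given by the extreme weight part of one on `A[X]`. -/
noncomputable def extreme [IsDomain A] (hq : 0 < q)
    (hC : ∀ a, HasWeightLE p 0 (ψ.expandHom q (C a)))
    (hX : HasWeightLE p q (ψ.expandHom q X)) : ExpMap k A :=
  ofCoeff (extremeHom hC)
    (fun a => by
      change (topWeight p 0 (ψ.expandHom q (C a))).coeff 0 = a
      rw [coeff_topWeight, coeff_expandHom, D_zero]
      simp)
    (fun a i j => by
      change (topWeight p 0 (ψ.expandHom q (C ((topWeight p 0 (ψ.expandHom q (C a))).coeff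
        i)))).coeff j = _ * (topWeight p 0 (ψ.expandHom q (C a))).coeff (i + j)
      rw [← topWeight_expandHom_D]
      have h1 := hC a i
      rw [coeff_expandHom, natDegree_expand] at h1
      rw [coeff_topWeight p 0 _ i, coeff_expandHom, coeff_expand hq]
      split_ifs with hd
      · obtain ⟨m, hm⟩ := hd
        rw [hm, mul_comm] at h1
        rw [hm, Nat.mul_div_cancel_left _ hq,
          topWeight_expandHom hq hC hX (Nat.le_of_mul_le_mul_left h1 hq),
          topWeight_expandHom_X hq hC hX, one_pow, mul_one]
      · have h2 : q * (ψ.D i (C a)).natDegree ≠ 0 + p * i := fun h => hd ⟨_, h.symm⟩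
        rw [(hasWeightLE_expandHom hC hX le_rfl).topWeight_eq_zero
          (lt_of_le_of_ne (by rwa [mul_comm]) h2), coeff_zero, C_0, map_zero]
        simp)

theorem coeff_extreme [IsDomain A] (hq : 0 < q)
    (hC : ∀ a, HasWeightLE p 0 (ψ.expandHom q (C a)))
    (hX : HasWeightLE p q (ψ.expandHom q X)) (a : A) (i : ℕ) :
    (extreme hq hC hX).D i a = (expand A q (ψ.D i (C a))).coeff (0 + p * i) := by
  rw [← coeff_expandHom, ← coeff_topWeight]
  rfl

variable (ψ) in
theorem exists_slope [Algebra.FiniteType k A] (h : ∃ a, ψ.toFun (C a) ≠ C (C a)) :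
    ∃ p q : ℕ, 0 < q ∧ (∀ a, HasWeightLE p 0 (ψ.expandHom q (C a))) ∧
      HasWeightLE p q (ψ.expandHom q X) ∧ ∃ f i, (f = X ∨ ∃ a, f = C a) ∧ 0 < i ∧ ψ.D i f ≠ 0 ∧
        q * (ψ.D i f).natDegree = q * f.natDegree + p * i := by
  classical
  obtain ⟨S, hS⟩ := Algebra.FiniteType.out (R := k) (A := A)
  let F : Finset A[X] := insert X (S.image C)
  let Q : Finset ℚ := F.biUnion fun f => ((ψ.toFun f).support.erase 0).image fun i =>
    (((ψ.D i f).natDegree : ℚ) - f.natDegree) / i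
  have hmem : ∀ r, r ∈ Q ↔ ∃ f ∈ F, ∃ i, (i ≠ 0 ∧ ψ.D i f ≠ 0) ∧
      (((ψ.D i f).natDegree : ℚ) - f.natDegree) / i = r := by
    intro r
    simp only [Q, Finset.mem_biUnion, Finset.mem_image, Finset.mem_erase, mem_support_iff]
    rfl
  obtain ⟨s, hs, hs'⟩ : ∃ s ∈ S, C s ∉ ψ.invariants := by
    by_contra! hcon
    obtain ⟨a, ha⟩ := h
    refine ha ?_
    have : Algebra.adjoin k (S : Set A) ≤ ψ.invariants.comap CAlgHom :=
      Algebra.adjoin_le fun s hs => hcon s hs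
    rw [hS] at this
    exact this (Algebra.mem_top (x := a))
  rw [mem_invariants_iff_D] at hs'
  push Not at hs'
  obtain ⟨i₀, hi₀, hD₀⟩ := hs'
  have hr₀ : (((ψ.D i₀ (C s)).natDegree : ℚ) - (C s).natDegree) / i₀ ∈ Q :=
    (hmem _).mpr ⟨C s, Finset.mem_insert_of_mem (Finset.mem_image_of_mem _ hs), i₀,
      ⟨hi₀.ne', hD₀⟩, rfl⟩
  have hM0 : 0 ≤ Q.max' ⟨_, hr₀⟩ := by
    refine le_trans ?_ (Finset.le_max' _ _ hr₀)
    rw [natDegree_C, Nat.cast_zero, sub_zero]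
    positivity
  set M := Q.max' ⟨_, hr₀⟩ with hM
  have hMpq : M = (M.num.toNat : ℚ) / (M.den : ℚ) := by
    conv_lhs => rw [← Rat.num_div_den M]
    congr 1
    exact_mod_cast (Int.toNat_of_nonneg (Rat.num_nonneg.mpr hM0)).symm
  set p := M.num.toNat
  set q := M.den with hq'
  have hq : 0 < q := M.den_pos
  have hqQ : (0 : ℚ) < q := by exact_mod_cast hq
  have key : ∀ f ∈ F, HasWeightLE p (q * f.natDegree) (ψ.expandHom q f) := by
    intro f hf i
    rw [coeff_expandHom, natDegree_expand, mul_comm]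
    rcases Nat.eq_zero_or_pos i with rfl | hi
    · simp
    · by_cases hD : ψ.D i f = 0
      · simp [hD]
      · have h1 := Finset.le_max' _ _ ((hmem _).mpr ⟨f, hf, i, ⟨hi.ne', hD⟩, rfl⟩)
        rw [← hM, hMpq, div_le_div_iff₀ (by exact_mod_cast hi) hqQ] at h1
        have h2 : (q * (ψ.D i f).natDegree : ℚ) ≤ q * f.natDegree + p * i := by linarith
        exact_mod_cast h2
  refine ⟨p, q, hq, ?_, ?_, ?_⟩
  · intro a
    have ha : a ∈ Algebra.adjoin k (S : Set A) := hS ▸ Algebra.mem_top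
    induction ha using Algebra.adjoin_induction with
    | mem s hs =>
      have := key (C s) (Finset.mem_insert_of_mem (Finset.mem_image_of_mem _ hs))
      rwa [natDegree_C, mul_zero] at this
    | algebraMap r =>
      intro i
      have h : ψ.toFun (C (algebraMap k A r)) = C (C (algebraMap k A r)) := ψ.toFun.commutes r
      rw [coeff_expandHom, D_apply, h, coeff_C]
      split_ifs <;> simp
    | add a b _ _ ha hb => rw [C_add, map_add]; exact ha.add hb
    | mul a b _ _ ha hb => rw [C_mul, map_mul]; exact ha.mul hb
  · intro i
    refine (key X (Finset.mem_insert_self _ _) i).trans ?_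
    gcongr
    exact (Nat.mul_le_mul_left q natDegree_X_le).trans (mul_one q).le
  · obtain ⟨f, hf, i, ⟨hi, hD⟩, hfi⟩ := (hmem _).mp (Q.max'_mem ⟨_, hr₀⟩)
    refine ⟨f, i, ?_, Nat.pos_of_ne_zero hi, hD, ?_⟩
    · rcases Finset.mem_insert.mp hf with h | h
      · exact Or.inl h
      · obtain ⟨a, _, ha⟩ := Finset.mem_image.mp h
        exact Or.inr ⟨a, ha.symm⟩
    · rw [← hM, hMpq, div_eq_div_iff (by exact_mod_cast hi) hqQ.ne'] at hfi
      have h2 : (q * (ψ.D i f).natDegree : ℚ) = q * f.natDegree + p * i := by linarith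
      exact_mod_cast h2

theorem exists_nontrivial_of_polynomial [IsDomain A] [Algebra.FiniteType k A] (ψ : ExpMap k A[X])
    (h : ∃ a, ψ.toFun (C a) ≠ C (C a)) : ∃ φ : ExpMap k A, φ.Nontrivial := by
  obtain ⟨p, q, hq, hC, hX, f, i, hf, hi, hD, hfi⟩ := exists_slope ψ h
  rcases hf with rfl | ⟨a, rfl⟩
  · exfalso
    have h1 := congrArg (fun P => P.coeff i) (topWeight_expandHom_X hq hC hX)
    simp only [coeff_topWeight, coeff_expandHom] at h1
    rw [natDegree_X, mul_one] at hfi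
    rw [← hfi, mul_comm, coeff_expand_mul hq, coeff_one, if_neg hi.ne'] at h1
    exact hD (leadingCoeff_eq_zero.mp h1)
  · refine ⟨extreme hq hC hX, a, fun h1 => hD ?_⟩
    have h2 := mem_invariants_iff_D.mp (mem_invariants.mpr h1) i hi
    rw [natDegree_C, mul_zero] at hfi
    rw [coeff_extreme, ← hfi, mul_comm, coeff_expand_mul hq] at h2
    exact leadingCoeff_eq_zero.mp h2

end ExpMap

end Homogenization

section Descent

open Polynomial TensorProduct

variable {L E R : Type*} [Field L] [Algebra k L] [CommRing E] [Algebra k E] [CommRing R]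
  [Algebra k R]

theorem natDegree_le_of_degree_lt_succ {S : Type*} [Semiring S] {p : S[X]} {n : ℕ}
    (h : p.degree < ((n + 1 : ℕ) : WithBot ℕ)) : p.natDegree ≤ n :=
  natDegree_le_iff_coeff_eq_zero.mpr fun m hm => (degree_lt_iff_coeff_zero _ _).mp h m hm

theorem exists_smul_coeff_eq [IsDomain (L ⊗[k] R)] (θ : L ⊗[k] E ≃ₐ[L] L[X])
    (ψ : E →ₐ[k] R[X]) (hψ : ∃ e, 0 < (ψ e).natDegree) {N : ℕ} {e e' : E}
    (he : (θ (1 ⊗ₜ e)).natDegree = N) (he' : (θ (1 ⊗ₜ e')).natDegree = N) (h0 : e' ≠ 0) :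
    ∃ c : k, (θ (1 ⊗ₜ e)).coeff N = c • (θ (1 ⊗ₜ e')).coeff N := by
  let i : R →ₐ[k] L ⊗[k] R := Algebra.TensorProduct.includeRight
  have hi : Function.Injective i := Algebra.TensorProduct.includeRight_injective
    (algebraMap k L).injective
  let ψL : L ⊗[k] E →ₐ[L] (L ⊗[k] R)[X] :=
    Algebra.TensorProduct.lift (Algebra.ofId L _) ((Polynomial.mapAlgHom i).comp ψ)
      fun _ _ => Commute.all _ _
  have hψL : ∀ e, ψL (1 ⊗ₜ e) = (ψ e).map i.toRingHom := fun e => by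
    rw [Algebra.TensorProduct.lift_tmul, map_one, one_mul]
    rfl
  let H : (L ⊗[k] R)[X] := ψL (θ.symm X)
  have hH : ∀ e, (ψ e).map i.toRingHom = aeval H (θ (1 ⊗ₜ e)) := fun e => by
    have h1 : aeval H = ψL.comp θ.symm.toAlgHom := by
      ext
      simp [H]
    rw [← hψL, h1]
    simp
  have hH' : ∀ e, (ψ e).map i.toRingHom =
      ((θ (1 ⊗ₜ e)).map (algebraMap L (L ⊗[k] R))).comp H := fun e => by
    rw [hH, comp, eval₂_map]
    rfl
  have hn : H.natDegree ≠ 0 := by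
    intro hn
    obtain ⟨e, he⟩ := hψ
    have h1 := congrArg natDegree (hH' e)
    rw [natDegree_comp, hn, mul_zero, natDegree_map_eq_of_injective hi] at h1
    exact he.ne' h1
  have hlead : ∀ e, (θ (1 ⊗ₜ e)).natDegree = N →
      algebraMap L (L ⊗[k] R) ((θ (1 ⊗ₜ e)).coeff N) * H.leadingCoeff ^ N =
        1 ⊗ₜ (ψ e).leadingCoeff := by
    rintro e rfl
    have h1 := congrArg leadingCoeff (hH' e)
    rw [leadingCoeff_map_of_injective hi, leadingCoeff_comp hn,
      leadingCoeff_map_of_injective (algebraMap L (L ⊗[k] R)).injective,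
      natDegree_map_eq_of_injective (algebraMap L (L ⊗[k] R)).injective] at h1
    exact h1.symm
  by_contra hcon
  have hnot : (θ (1 ⊗ₜ e)).coeff N ∉ Submodule.span k {(θ (1 ⊗ₜ e')).coeff N} := by
    intro h
    obtain ⟨c, hc⟩ := Submodule.mem_span_singleton.mp h
    exact hcon ⟨c, hc.symm⟩
  obtain ⟨ℓ, hℓ, hℓ'⟩ := Submodule.exists_le_ker_of_notMem hnot
  have hℓ0 : ℓ ((θ (1 ⊗ₜ e')).coeff N) = 0 := hℓ' (Submodule.mem_span_singleton_self _)
  have key : (θ (1 ⊗ₜ e')).coeff N ⊗ₜ[k] (ψ e).leadingCoeff =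
      (θ (1 ⊗ₜ e)).coeff N ⊗ₜ[k] (ψ e').leadingCoeff := by
    have h1 := hlead e he
    have h2 := hlead e' he'
    have h3 : ∀ (l : L) (r : R), l ⊗ₜ[k] r = algebraMap L (L ⊗[k] R) l * 1 ⊗ₜ r := fun l r => by
      rw [Algebra.TensorProduct.algebraMap_apply]
      simp
    rw [h3, h3 _ (ψ e').leadingCoeff, ← h1, ← h2]
    ring
  have h4 := congrArg (tensorSlice ℓ) key
  rw [tensorSlice_tmul, tensorSlice_tmul, hℓ0, zero_smul, eq_comm, smul_eq_zero,
    or_iff_right hℓ] at h4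
  have h5 := hlead e' he'
  have hH0 : H.leadingCoeff ≠ 0 := fun h => hn (by rw [leadingCoeff_eq_zero.mp h, natDegree_zero])
  rw [h4, tmul_zero, mul_eq_zero, or_iff_left (pow_ne_zero _ hH0),
    map_eq_zero_iff _ (algebraMap L (L ⊗[k] R)).injective, ← he', coeff_natDegree,
    leadingCoeff_eq_zero, map_eq_zero_iff _ θ.injective] at h5
  exact h0 (ExpMap.one_tmul_injective (L := L) (h5.trans (tmul_zero _ _).symm))

/-- A form of the affine line, with a coordinate ring mapping nontrivially to some `R[X]`,
is trivial. -/
theorem nonempty_algEquiv_polynomial [IsDomain (L ⊗[k] R)] (θ : L ⊗[k] E ≃ₐ[L] L[X])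
    (ψ : E →ₐ[k] R[X]) (hψ : ∃ e, 0 < (ψ e).natDegree) : Nonempty (E ≃ₐ[k] k[X]) := by
  let P : E →ₐ[k] L[X] :=
    (θ.toAlgHom.restrictScalars k).comp Algebra.TensorProduct.includeRight
  have hPinj : Function.Injective P := θ.injective.comp ExpMap.one_tmul_injective
  have hratio : ∀ {N : ℕ} {e e' : E}, (P e).natDegree ≤ N → (P e').natDegree = N → e' ≠ 0 →
      ∃ c : k, (P (e - c • e')).degree < N := by
    intro N e e' he he' h0
    have hle : (P e).degree ≤ N := natDegree_le_iff_degree_le.mp he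
    have hle' : (P e').degree ≤ N := natDegree_le_iff_degree_le.mp he'.le
    have h : ∃ c : k, (P e).coeff N = c • (P e').coeff N := by
      rcases he.lt_or_eq with h | h
      · exact ⟨0, by rw [coeff_eq_zero_of_natDegree_lt h, zero_smul]⟩
      · exact exists_smul_coeff_eq θ ψ hψ h he' h0
    obtain ⟨c, hc⟩ := h
    refine ⟨c, lt_of_le_of_ne ?_ fun h => coeff_ne_zero_of_eq_degree h ?_⟩
    · rw [map_sub, map_smul]
      exact (degree_sub_le _ _).trans (max_le hle ((degree_smul_le _ _).trans hle'))
    · rw [map_sub, map_smul, coeff_sub, hc, coeff_smul, sub_self]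
  let S : ℕ → Submodule L L[X] := fun N => Submodule.span L {Q | ∃ e, Q = P e ∧ Q.natDegree ≤ N}
  have hSdeg : ∀ N {Q : L[X]}, Q ∈ S N → Q.natDegree ≤ N := by
    intro N Q hQ
    have : S N ≤ degreeLE L N := by
      refine Submodule.span_le.mpr ?_
      rintro _ ⟨e, rfl, h⟩
      exact mem_degreeLE.mpr (natDegree_le_iff_degree_le.mp h)
    exact natDegree_le_iff_degree_le.mpr (mem_degreeLE.mp (this hQ))
  have hSmono : Monotone S := fun M N h => Submodule.span_mono (by
    rintro _ ⟨e, h1, h2⟩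
    exact ⟨e, h1, h2.trans h⟩)
  have hS : ∀ N (Q : L[X]), Q ∈ S (N + 1) → Q.natDegree ≤ N → Q ∈ S N := by
    intro N Q hQ hQN
    by_cases h : ∃ e₀, (P e₀).natDegree = N + 1
    · obtain ⟨e₀, he₀⟩ := h
      have hP0 : P e₀ ≠ 0 := fun h => by
        rw [h, natDegree_zero] at he₀
        omega
      have h0 : e₀ ≠ 0 := fun h => hP0 (by rw [h, map_zero])
      have hle : S (N + 1) ≤ Submodule.span L {P e₀} ⊔ S N := by
        refine Submodule.span_le.mpr ?_
        rintro _ ⟨e, rfl, he⟩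
        obtain ⟨c, hc⟩ := hratio he he₀ h0
        have h1 : P e = algebraMap k L c • P e₀ + P (e - c • e₀) := by
          rw [map_sub, map_smul, algebraMap_smul]
          ring
        rw [h1]
        refine Submodule.add_mem_sup (Submodule.smul_mem _ _ (Submodule.mem_span_singleton_self _))
          (Submodule.subset_span ⟨_, rfl, ?_⟩)
        exact natDegree_le_of_degree_lt_succ hc
      obtain ⟨Q₁, hQ₁, Q₂, hQ₂, rfl⟩ := Submodule.mem_sup.mp (hle hQ)
      obtain ⟨β, rfl⟩ := Submodule.mem_span_singleton.mp hQ₁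
      have h1 : Q₂.coeff (N + 1) = 0 :=
        coeff_eq_zero_of_natDegree_lt (Nat.lt_succ_of_le (hSdeg N hQ₂))
      have h2 : (β • P e₀ + Q₂).coeff (N + 1) = 0 :=
        coeff_eq_zero_of_natDegree_lt (Nat.lt_succ_of_le hQN)
      rw [coeff_add, h1, add_zero, coeff_smul, smul_eq_mul, mul_eq_zero] at h2
      rcases h2 with h2 | h2
      · rwa [h2, zero_smul, zero_add]
      · rw [← he₀] at h2
        exact absurd (leadingCoeff_eq_zero.mp h2) hP0
    · refine Submodule.span_mono ?_ hQ
      rintro _ ⟨e, rfl, he⟩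
      refine ⟨e, rfl, Nat.lt_succ_iff.mp (lt_of_le_of_ne he fun h' => h ⟨e, h'⟩)⟩
  have hSX : ∃ N, X ∈ S N := by
    have h : ∀ t, ∃ N, θ t ∈ S N := by
      intro t
      induction t with
      | zero => exact ⟨0, by rw [map_zero]; exact zero_mem _⟩
      | add t₁ t₂ h₁ h₂ =>
        obtain ⟨N₁, h₁⟩ := h₁
        obtain ⟨N₂, h₂⟩ := h₂
        refine ⟨max N₁ N₂, ?_⟩
        rw [map_add]
        exact add_mem (hSmono (le_max_left _ _) h₁) (hSmono (le_max_right _ _) h₂)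
      | tmul l e =>
        refine ⟨(P e).natDegree, ?_⟩
        rw [← mul_one l, ← smul_eq_mul, ← smul_tmul', map_smul]
        exact Submodule.smul_mem _ _ (Submodule.subset_span ⟨e, rfl, le_rfl⟩)
    obtain ⟨N, hN⟩ := h (θ.symm X)
    exact ⟨N, by rwa [θ.apply_symm_apply] at hN⟩
  have hS1 : X ∈ S 1 := by
    obtain ⟨N, hN⟩ := hSX
    induction N with
    | zero => exact Submodule.span_mono (by rintro _ ⟨e, h, h'⟩; exact ⟨e, h, by omega⟩) hN
    | succ N ih =>
      rcases Nat.eq_zero_or_pos N with rfl | hpos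
      · exact hN
      · exact ih (hS N X hN (natDegree_X_le.trans hpos))
  obtain ⟨e, he⟩ : ∃ e, (P e).natDegree = 1 := by
    by_contra! hcon
    have h : S 1 ≤ S 0 := Submodule.span_mono (by
      rintro _ ⟨e, rfl, h⟩
      refine ⟨e, rfl, ?_⟩
      have := hcon e
      omega)
    have := hSdeg 0 (h hS1)
    rw [natDegree_X] at this
    omega
  have hdeg : ∀ p : k[X], (P (aeval e p)).natDegree = p.natDegree := by
    intro p
    have h : P (aeval e p) = (p.map (algebraMap k L)).comp (P e) := by
      rw [← aeval_algHom_apply, comp, eval₂_map]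
      rfl
    rw [h, natDegree_comp, he, mul_one, natDegree_map]
  refine ⟨(AlgEquiv.ofBijective (aeval e) ⟨?_, ?_⟩).symm⟩
  · refine (injective_iff_map_eq_zero _).mpr fun p hp => ?_
    have h1 := hdeg p
    rw [hp, map_zero, natDegree_zero] at h1
    rw [eq_C_of_natDegree_eq_zero h1.symm, aeval_C] at hp
    have h2 : P (algebraMap k E (p.coeff 0)) = 0 := by rw [hp, map_zero]
    rw [AlgHom.commutes, map_eq_zero_iff _ (algebraMap k L[X]).injective] at h2
    rw [eq_C_of_natDegree_eq_zero h1.symm, h2, C_0]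
  · have hP0 : P e ≠ 0 := fun h => by
      rw [h, natDegree_zero] at he
      omega
    have hrange : ∀ N e', (P e').degree < (N : ℕ) → e' ∈ (aeval (R := k) e).range := by
      intro N
      induction N with
      | zero =>
        intro e' he'
        have h0 : P e' = 0 := degree_eq_bot.mp (Nat.WithBot.lt_zero_iff.mp he')
        rw [hPinj (h0.trans (map_zero P).symm)]
        exact zero_mem _
      | succ N ih =>
        intro e' he'
        have h0 : e ^ N ≠ 0 := fun h => pow_ne_zero N hP0 (by rw [← map_pow, h, map_zero])
        have h1 := hdeg (X ^ N)
        rw [map_pow, aeval_X, natDegree_X_pow] at h1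
        obtain ⟨c, hc⟩ :=
          hratio (natDegree_le_of_degree_lt_succ he') h1 h0
        have h2 := add_mem (ih _ hc) (Subalgebra.smul_mem _ (⟨X ^ N, by simp⟩ : e ^ N ∈
          (aeval (R := k) e).range) c)
        rwa [sub_add_cancel] at h2
    intro e'
    exact hrange _ e' (lt_of_le_of_lt degree_le_natDegree
      (WithBot.coe_lt_coe.mpr (Nat.lt_succ_self _)))

end Descent

section Jacobian

open Polynomial

variable {K : Type*} [Field K]

/-- The coefficientwise derivative on bivariate polynomials. -/
noncomputable def derivativeCoeff : Derivation K K[X][X] K[X][X] :=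
  PolynomialModule.equivPolynomialSelf.toLinearMap.compDer
    (derivative' : Derivation K K[X] K[X]).mapCoeffs

theorem coeff_derivativeCoeff (f : K[X][X]) (i : ℕ) :
    (derivativeCoeff f).coeff i = derivative (f.coeff i) := rfl

/-- The derivative of bivariate polynomials in the outer variable. -/
noncomputable def derivativeOuter : Derivation K K[X][X] K[X][X] :=
  (derivative' : Derivation K[X] K[X][X] K[X][X]).restrictScalars K

theorem derivativeOuter_apply (f : K[X][X]) : derivativeOuter f = derivative f := rfl

/-- The Jacobian determinant of two bivariate polynomials. -/
noncomputable def jacobian (f g : K[X][X]) : K[X][X] :=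
  derivativeCoeff f * derivativeOuter g - derivativeOuter f * derivativeCoeff g

theorem derivation_algHom_apply (Φ : K[X][X] →ₐ[K] K[X][X]) (δ : Derivation K K[X][X] K[X][X])
    (f : K[X][X]) : δ (Φ f) =
      Φ (derivativeCoeff f) * δ (Φ (C X)) + Φ (derivativeOuter f) * δ (Φ X) := by
  have hadd : ∀ f g : K[X][X],
      δ (Φ f) = Φ (derivativeCoeff f) * δ (Φ (C X)) + Φ (derivativeOuter f) * δ (Φ X) →
      δ (Φ g) = Φ (derivativeCoeff g) * δ (Φ (C X)) + Φ (derivativeOuter g) * δ (Φ X) →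
      δ (Φ (f + g)) = Φ (derivativeCoeff (f + g)) * δ (Φ (C X)) +
        Φ (derivativeOuter (f + g)) * δ (Φ X) := by
    intro f g hf hg
    simp only [map_add, hf, hg]
    ring
  have hmul : ∀ f g : K[X][X],
      δ (Φ f) = Φ (derivativeCoeff f) * δ (Φ (C X)) + Φ (derivativeOuter f) * δ (Φ X) →
      δ (Φ g) = Φ (derivativeCoeff g) * δ (Φ (C X)) + Φ (derivativeOuter g) * δ (Φ X) →
      δ (Φ (f * g)) = Φ (derivativeCoeff (f * g)) * δ (Φ (C X)) +
        Φ (derivativeOuter (f * g)) * δ (Φ X) := by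
    intro f g hf hg
    simp only [map_mul, Derivation.leibniz, smul_eq_mul, map_add, hf, hg]
    ring
  have hCX : derivativeCoeff (C X : K[X][X]) = 1 := by
    ext i : 1
    rw [coeff_derivativeCoeff, coeff_C, coeff_one]
    split_ifs <;> simp
  have hX : derivativeCoeff (X : K[X][X]) = 0 := by
    ext i : 1
    rw [coeff_derivativeCoeff, coeff_X, coeff_zero]
    split_ifs <;> simp
  have hX' : derivativeOuter (X : K[X][X]) = 1 := derivative_X
  have hconst : ∀ a : K, δ (Φ (C (C a))) = Φ (derivativeCoeff (C (C a))) * δ (Φ (C X)) +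
      Φ (derivativeOuter (C (C a))) * δ (Φ X) := by
    intro a
    have h : (C (C a) : K[X][X]) = algebraMap K _ a := rfl
    rw [h, AlgHom.commutes, Derivation.map_algebraMap, Derivation.map_algebraMap,
      Derivation.map_algebraMap, map_zero]
    ring
  have hCX' : derivativeOuter (C X : K[X][X]) = 0 := derivative_C
  have h1 : δ (Φ (C X)) = Φ (derivativeCoeff (C X)) * δ (Φ (C X)) +
      Φ (derivativeOuter (C X)) * δ (Φ X) := by
    rw [hCX, hCX', map_one, map_zero]
    ring
  have h2 : δ (Φ X) = Φ (derivativeCoeff X) * δ (Φ (C X)) +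
      Φ (derivativeOuter X) * δ (Φ X) := by
    rw [hX, hX', map_one, map_zero]
    ring
  induction f using Polynomial.induction_on with
  | C p =>
    induction p using Polynomial.induction_on with
    | C a => exact hconst a
    | add p q hp hq => rw [C_add]; exact hadd _ _ hp hq
    | monomial n a h =>
      rw [pow_succ, ← mul_assoc, C_mul]
      exact hmul _ _ h h1
  | add f g hf hg => exact hadd _ _ hf hg
  | monomial n p h =>
    rw [pow_succ, ← mul_assoc]
    exact hmul _ _ h h2

theorem jacobian_algHom (Φ : K[X][X] →ₐ[K] K[X][X]) (f g : K[X][X]) :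
    jacobian (Φ f) (Φ g) = Φ (jacobian f g) * jacobian (Φ (C X)) (Φ X) := by
  rw [jacobian, derivation_algHom_apply Φ derivativeCoeff f,
    derivation_algHom_apply Φ derivativeCoeff g,
    derivation_algHom_apply Φ derivativeOuter f, derivation_algHom_apply Φ derivativeOuter g,
    jacobian, jacobian, map_sub, map_mul, map_mul]
  ring

theorem jacobian_C_X_X : jacobian (C X : K[X][X]) X = 1 := by
  have hCX : derivativeCoeff (C X : K[X][X]) = 1 := by
    ext i : 1
    rw [coeff_derivativeCoeff, coeff_C, coeff_one]
    split_ifs <;> simp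
  have hX' : derivativeOuter (X : K[X][X]) = 1 := derivative_X
  have hCX' : derivativeOuter (C X : K[X][X]) = 0 := derivative_C
  rw [jacobian, hCX, hX', hCX']
  ring

theorem coeff_zero_jacobian (f g : K[X][X]) : ((jacobian f g).coeff 0).coeff 0 =
    (f.coeff 0).coeff 1 * (g.coeff 1).coeff 0 - (f.coeff 1).coeff 0 * (g.coeff 0).coeff 1 := by
  simp [jacobian, mul_coeff_zero, coeff_derivativeCoeff, derivativeOuter_apply, coeff_derivative]

end Jacobian

section Rees

open Polynomial

variable {R : Type*} [CommRing R]

/-- The embedding of the polynomial ring over a Rees algebra in a bivariate polynomial ring. -/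
noncomputable def reesEmbedding (K : Type*) [Field K] [Algebra R K] (J : Ideal R) :
    (reesAlgebra J)[X] →ₐ[R] K[X][X] :=
  mapAlgHom ((mapAlgHom (Algebra.ofId R K)).comp (reesAlgebra J).val)

variable {K : Type*} [Field K] [Algebra R K]

theorem coeff_coeff_reesEmbedding (J : Ideal R) (f : (reesAlgebra J)[X]) (m n : ℕ) :
    ((reesEmbedding K J f).coeff m).coeff n =
      algebraMap R K ((f.coeff m : R[X]).coeff n) := by
  rw [reesEmbedding, coe_mapAlgHom, coeff_map]
  change (((f.coeff m : R[X])).map (algebraMap R K)).coeff n = _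
  rw [coeff_map]

/-- The element `r X` of the Rees algebra, for `r` in the ideal. -/
noncomputable def reesMonomial {J : Ideal R} {r : R} (hr : r ∈ J) : reesAlgebra J :=
  ⟨monomial 1 r, reesAlgebra.monomial_mem.mpr (by rwa [pow_one])⟩

theorem reesEmbedding_C_reesMonomial {J : Ideal R} {r : R} (hr : r ∈ J) :
    reesEmbedding K J (C (reesMonomial hr)) = C (C (algebraMap R K r)) * C X := by
  rw [reesEmbedding, coe_mapAlgHom, map_C, ← C_mul, C_mul_X_eq_monomial]
  change C ((monomial 1 r).map (algebraMap R K)) = _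
  rw [map_monomial]

theorem reesEmbedding_X (J : Ideal R) : reesEmbedding K J X = X := map_X _

theorem exists_algHom_reesEmbedding [FaithfulSMul R K] {J J' : Ideal R} (hJ : J ≠ ⊥)
    (Θ : (reesAlgebra J)[X] →ₐ[R] (reesAlgebra J')[X]) :
    ∃ Φ : K[X][X] →ₐ[K] K[X][X], ∀ f, Φ (reesEmbedding K J f) = reesEmbedding K J' (Θ f) := by
  obtain ⟨j, hj, hj0⟩ := Submodule.exists_mem_ne_zero_of_ne_bot hJ
  have hjK : algebraMap R K j ≠ 0 := by
    rwa [Ne, map_eq_zero_iff _ (FaithfulSMul.algebraMap_injective R K)]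
  let u : K[X][X] := C (C (algebraMap R K j)⁻¹) * reesEmbedding K J' (Θ (C (reesMonomial hj)))
  have hu : C (C (algebraMap R K j)) * u = reesEmbedding K J' (Θ (C (reesMonomial hj))) := by
    rw [← mul_assoc, ← C_mul, ← C_mul, mul_inv_cancel₀ hjK, C_1, C_1, one_mul]
  let Φ : K[X][X] →ₐ[K] K[X][X] :=
    eval₂AlgHom (aeval u) (reesEmbedding K J' (Θ X)) fun _ => Commute.all _ _
  have hΦX : Φ X = reesEmbedding K J' (Θ X) := eval₂_X _ _
  have hΦCX : Φ (C X) = u := (eval₂_C _ _).trans (aeval_X _)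
  let g₁ : reesAlgebra J →ₐ[R] K[X][X] :=
    ((Φ.restrictScalars R).comp (reesEmbedding K J)).comp CAlgHom
  let g₂ : reesAlgebra J →ₐ[R] K[X][X] := ((reesEmbedding K J').comp Θ).comp CAlgHom
  have hg : ∀ a, g₁ a = g₂ a := by
    have h : reesAlgebra J ≤ (AlgHom.equalizer g₁ g₂).map (reesAlgebra J).val := by
      refine (adjoin_monomial_eq_reesAlgebra J).symm.trans_le (Algebra.adjoin_le ?_)
      rintro _ ⟨r, hr, rfl⟩
      refine ⟨reesMonomial hr, ?_, rfl⟩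
      change Φ (reesEmbedding K J (C (reesMonomial hr))) =
        reesEmbedding K J' (Θ (C (reesMonomial hr)))
      have hsmul : ∀ (r : R) (f : K[X][X]), C (C (algebraMap R K r)) * f = r • f := fun r f => by
        rw [Algebra.smul_def]
        rfl
      have hcomm : r • C (reesMonomial hj) = j • C (reesMonomial hr) := by
        rw [smul_C, smul_C]
        congr 1
        refine Subtype.ext ?_
        change r • monomial 1 j = j • monomial 1 r
        rw [smul_monomial, smul_monomial, smul_eq_mul, smul_eq_mul, mul_comm]
      have hjj : (C (C (algebraMap R K j)) : K[X][X]) ≠ 0 := by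
        rwa [Ne, C_eq_zero, C_eq_zero]
      refine mul_left_cancel₀ hjj ?_
      have hc : Φ (C (C (algebraMap R K r))) = C (C (algebraMap R K r)) := Φ.commutes _
      rw [reesEmbedding_C_reesMonomial, map_mul, hΦCX, hc, mul_left_comm, hu, hsmul, hsmul,
        ← map_smul, ← map_smul, hcomm, map_smul, map_smul]
    rintro ⟨P, hP⟩
    obtain ⟨a, ha, haP⟩ := h hP
    have : a = ⟨P, hP⟩ := Subtype.ext haP
    exact this ▸ ha
  refine ⟨Φ, fun f => ?_⟩
  induction f using Polynomial.induction_on with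
  | C a => exact hg a
  | add f g hf hg => simp only [map_add, hf, hg]
  | monomial n a h =>
    rw [pow_succ, ← mul_assoc, map_mul, map_mul, h, reesEmbedding_X, hΦX, ← map_mul, ← map_mul]

theorem exists_mul_jacobian_eq {J J' : Ideal R} (Θ : (reesAlgebra J)[X] →ₐ[R] (reesAlgebra J')[X])
    {Φ : K[X][X] →ₐ[K] K[X][X]}
    (hΦ : ∀ f, Φ (reesEmbedding K J f) = reesEmbedding K J' (Θ f)) {r : R} (hr : r ∈ J) :
    ∃ s ∈ J', algebraMap R K r * ((jacobian (Φ (C X)) (Φ X)).coeff 0).coeff 0 =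
      algebraMap R K s := by
  let f := Θ (C (reesMonomial hr))
  let g := Θ X
  have h1 : (C (C (algebraMap R K r)) : K[X][X]) * jacobian (Φ (C X)) (Φ X) =
      jacobian (reesEmbedding K J' f) (reesEmbedding K J' g) := by
    rw [← hΦ, ← hΦ, reesEmbedding_C_reesMonomial, reesEmbedding_X,
      jacobian_algHom Φ (C (C (algebraMap R K r)) * C X)]
    have h2 : jacobian (C (C (algebraMap R K r)) * C X : K[X][X]) X = C (C (algebraMap R K r)) := by
      have h3 : (C (C (algebraMap R K r)) * C X : K[X][X]) = algebraMap R K r • C X := by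
        rw [Algebra.smul_def]
        rfl
      have h4 := jacobian_C_X_X (K := K)
      rw [jacobian] at h4
      rw [h3, jacobian, Derivation.map_smul, Derivation.map_smul, smul_mul_assoc, smul_mul_assoc,
        ← smul_sub, h4, Algebra.smul_def, mul_one]
      rfl
    have h5 : Φ (C (C (algebraMap R K r))) = C (C (algebraMap R K r)) := Φ.commutes _
    rw [h2, h5]
  have h6 := congrArg (fun f => (f.coeff 0).coeff 0) h1
  simp only [coeff_zero_jacobian, coeff_coeff_reesEmbedding, coeff_C_mul] at h6
  refine ⟨(f.coeff 0 : R[X]).coeff 1 * (g.coeff 1 : R[X]).coeff 0 -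
    (f.coeff 1 : R[X]).coeff 0 * (g.coeff 0 : R[X]).coeff 1, ?_, ?_⟩
  · have h7 : ∀ P : reesAlgebra J', (P : R[X]).coeff 1 ∈ J' := fun P => by
      have := P.2 1
      rwa [pow_one] at this
    exact sub_mem (J'.mul_mem_right _ (h7 _)) (J'.mul_mem_left _ (h7 _))
  · rw [coeff_zero_jacobian, h6, map_sub, map_mul, map_mul]

theorem jacobian_mul_jacobian_eq_one [FaithfulSMul R K] {J J' : Ideal R} (hJ' : J' ≠ ⊥)
    (Θ : (reesAlgebra J)[X] ≃ₐ[R] (reesAlgebra J')[X])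
    {Φ Φ' : K[X][X] →ₐ[K] K[X][X]}
    (hΦ : ∀ f, Φ (reesEmbedding K J f) = reesEmbedding K J' (Θ f))
    (hΦ' : ∀ f, Φ' (reesEmbedding K J' f) = reesEmbedding K J (Θ.symm f)) :
    Φ (jacobian (Φ' (C X)) (Φ' X)) * jacobian (Φ (C X)) (Φ X) = 1 := by
  obtain ⟨j, hj, hj0⟩ := Submodule.exists_mem_ne_zero_of_ne_bot hJ'
  have hjK : algebraMap R K j ≠ 0 := by
    rwa [Ne, map_eq_zero_iff _ (FaithfulSMul.algebraMap_injective R K)]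
  have hjj : (C (C (algebraMap R K j)) : K[X][X]) ≠ 0 := by
    rwa [Ne, C_eq_zero, C_eq_zero]
  have hcomp : ∀ f, Φ (Φ' (reesEmbedding K J' f)) = reesEmbedding K J' f := fun f => by
    rw [hΦ', hΦ, AlgEquiv.apply_symm_apply]
  have hX : Φ (Φ' X) = X := by
    have := hcomp X
    rwa [reesEmbedding_X] at this
  have hCX : Φ (Φ' (C X)) = C X := by
    have h1 := hcomp (C (reesMonomial hj))
    have h2 : Φ' (C (C (algebraMap R K j))) = C (C (algebraMap R K j)) := Φ'.commutes _
    have h3 : Φ (C (C (algebraMap R K j))) = C (C (algebraMap R K j)) := Φ.commutes _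
    rw [reesEmbedding_C_reesMonomial, map_mul, map_mul, h2, h3] at h1
    exact mul_left_cancel₀ hjj h1
  rw [← jacobian_algHom, hX, hCX, jacobian_C_X_X]

theorem isUnit_iff_exists_C_C {f : K[X][X]} : IsUnit f ↔ ∃ c : K, c ≠ 0 ∧ f = C (C c) := by
  constructor
  · intro h
    obtain ⟨p, hp, rfl⟩ := Polynomial.isUnit_iff.mp h
    obtain ⟨c, hc, rfl⟩ := Polynomial.isUnit_iff.mp hp
    exact ⟨c, hc.ne_zero, rfl⟩
  · rintro ⟨c, hc, rfl⟩
    exact (hc.isUnit.map C).map C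

theorem exists_smul_ideal_eq [FaithfulSMul R K] {J J' : Ideal R} (hJ : J ≠ ⊥) (hJ' : J' ≠ ⊥)
    (Θ : (reesAlgebra J)[X] ≃ₐ[R] (reesAlgebra J')[X]) :
    ∃ c : K, c ≠ 0 ∧ (∀ r ∈ J, ∃ s ∈ J', algebraMap R K r * c = algebraMap R K s) ∧
      ∀ s ∈ J', ∃ r ∈ J, algebraMap R K r * c = algebraMap R K s := by
  obtain ⟨Φ, hΦ⟩ := exists_algHom_reesEmbedding (K := K) hJ Θ.toAlgHom
  obtain ⟨Φ', hΦ'⟩ := exists_algHom_reesEmbedding (K := K) hJ' Θ.symm.toAlgHom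
  have h1 := jacobian_mul_jacobian_eq_one hJ' Θ hΦ hΦ'
  have h2 := jacobian_mul_jacobian_eq_one hJ Θ.symm hΦ' hΦ
  obtain ⟨c, hc, hκ⟩ := isUnit_iff_exists_C_C.mp (IsUnit.of_mul_eq_one_right _ h1)
  obtain ⟨c', hc', hκ'⟩ := isUnit_iff_exists_C_C.mp (IsUnit.of_mul_eq_one_right _ h2)
  have h3 : Φ (C (C c')) = C (C c') := Φ.commutes _
  rw [hκ, hκ', h3, ← C_mul, ← C_mul] at h1
  have h4 : c' * c = 1 := C_injective (C_injective h1)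
  refine ⟨c, hc, fun r hr => ?_, fun s hs => ?_⟩
  · obtain ⟨s, hs, h⟩ := exists_mul_jacobian_eq Θ.toAlgHom hΦ hr
    rw [hκ, coeff_C_zero, coeff_C_zero] at h
    exact ⟨s, hs, h⟩
  · obtain ⟨r, hr, h⟩ := exists_mul_jacobian_eq Θ.symm.toAlgHom hΦ' hs
    rw [hκ', coeff_C_zero, coeff_C_zero] at h
    exact ⟨r, hr, by rw [← h, mul_assoc, h4, mul_one]⟩

/-- Rees algebras of nonzero ideals of a domain are cancellative relative to the base. -/
theorem nonempty_reesAlgebra_algEquiv [IsDomain R] {J J' : Ideal R} (hJ : J ≠ ⊥) (hJ' : J' ≠ ⊥)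
    (Θ : (reesAlgebra J)[X] ≃ₐ[R] (reesAlgebra J')[X]) :
    Nonempty (reesAlgebra J ≃ₐ[R] reesAlgebra J') := by
  let K := FractionRing R
  obtain ⟨c, hc, h1, h2⟩ := exists_smul_ideal_eq (K := K) hJ hJ' Θ
  let m : R[X] →ₐ[R] K[X] := mapAlgHom (Algebra.ofId R K)
  have hm : Function.Injective m := map_injective _ (FaithfulSMul.algebraMap_injective R K)
  let s : K[X] →ₐ[R] K[X] := (aeval (C c * X) : K[X] →ₐ[K] K[X]).restrictScalars R
  have hs : Function.Injective s := by
    have h : (aeval (C c⁻¹ * X) : K[X] →ₐ[K] K[X]).comp (aeval (C c * X)) = AlgHom.id K K[X] := by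
      refine algHom_ext ?_
      rw [AlgHom.comp_apply, aeval_X, map_mul, aeval_X, aeval_C, ← mul_assoc]
      change C c * C c⁻¹ * X = X
      rw [← C_mul, mul_inv_cancel₀ hc, C_1, one_mul]
    exact Function.LeftInverse.injective (g := aeval (C c⁻¹ * X)) fun P => AlgHom.congr_fun h P
  have hmm : ∀ r, m (monomial 1 r) = monomial 1 (algebraMap R K r) := fun r => map_monomial _
  have hsm : ∀ r, s (m (monomial 1 r)) = monomial 1 (algebraMap R K r * c) := by
    intro r
    rw [hmm]
    refine (aeval_monomial _).trans ?_
    change C _ * _ = _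
    rw [pow_one, ← mul_assoc, ← C_mul, C_mul_X_eq_monomial]
  have hrange : ∀ (J : Ideal R) (f : R[X] →ₐ[R] K[X]), (f.comp (reesAlgebra J).val).range =
      Algebra.adjoin R (f '' (Submodule.map (monomial 1 : R →ₗ[R] R[X]) J : Set R[X])) := by
    intro J f
    rw [AlgHom.range_comp, Subalgebra.range_val, ← adjoin_monomial_eq_reesAlgebra,
      AlgHom.map_adjoin]
  refine ⟨AlgEquiv.ofRangeEq ((s.comp m).comp (reesAlgebra J).val) (m.comp (reesAlgebra J').val)
    ((hs.comp hm).comp Subtype.val_injective) (hm.comp Subtype.val_injective) ?_⟩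
  rw [hrange, hrange]
  congr 1
  ext P
  constructor
  · rintro ⟨_, ⟨r, hr, rfl⟩, rfl⟩
    obtain ⟨s', hs', h⟩ := h1 r hr
    exact ⟨_, ⟨s', hs', rfl⟩, by rw [hmm, ← h, ← hsm]; rfl⟩
  · rintro ⟨_, ⟨s', hs', rfl⟩, rfl⟩
    obtain ⟨r, hr, h⟩ := h2 s' hs'
    exact ⟨_, ⟨r, hr, rfl⟩, by rw [hmm, ← h, ← hsm]; rfl⟩

end Rees

/-! ### Translations, transport and the cancellation theorem -/

section Cancellation

open Polynomial TensorProduct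

namespace ExpMap

/-- The translation action on a polynomial ring in one variable. -/
noncomputable def translation (k A : Type*) [Field k] [CommRing A] [Algebra k A] :
    ExpMap k A[X] :=
  have h (f : A[X]) (n : ℕ) :
      ((aeval (X + C X : A[X][X]) f).coeff n) = hasseDeriv n f := by
    have h : aeval (X + C X : A[X][X]) f = f.eval₂ (C.comp C) (X + C X) := rfl
    ext m
    rw [h, coeff_coeff_eval₂_X_add_C_X, hasseDeriv_coeff, add_comm m n]
  ofCoeff ((aeval (X + C X : A[X][X])).restrictScalars k)
    (fun f => by rw [AlgHom.restrictScalars_apply, h, hasseDeriv_zero']) fun f i j => by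
      simp only [AlgHom.restrictScalars_apply, h]
      rw [← LinearMap.comp_apply, hasseDeriv_comp, LinearMap.smul_apply, nsmul_eq_mul,
        add_comm j i, Nat.choose_symm_add]

theorem translation_toFun (f : A[X]) :
    (translation k A).toFun f = f.eval₂ (C.comp C) (X + C X) := rfl

theorem translation_toFun_eq_C {f : A[X]} (h : (translation k A).toFun f = C f) :
    f = C (f.coeff 0) := by
  ext n
  rcases Nat.eq_zero_or_pos n with rfl | hn
  · simp
  · have h1 := congrArg (fun P : A[X][X] => (P.coeff n).coeff 0) h
    simp only [translation_toFun, coeff_coeff_eval₂_X_add_C_X] at h1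
    rw [coeff_C_of_ne_zero hn.ne', coeff_zero, add_zero, Nat.choose_self, Nat.cast_one,
      one_mul] at h1
    rw [h1, coeff_C_of_ne_zero (Nat.ne_of_gt hn)]

/-- Transport of an exponential map along an isomorphism. -/
noncomputable def congr {B : Type*} [CommRing B] [Algebra k B] (e : A ≃ₐ[k] B)
    (φ : ExpMap k B) : ExpMap k A :=
  have h (a : A) (n : ℕ) :
      ((((mapAlgHom (e.symm : B →ₐ[k] A)).comp φ.toFun).comp (e : A →ₐ[k] B)) a).coeff n =
        e.symm (φ.D n (e a)) := coeff_map _ _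
  ofCoeff (((mapAlgHom (e.symm : B →ₐ[k] A)).comp φ.toFun).comp (e : A →ₐ[k] B))
    (fun a => by rw [h, D_zero, e.symm_apply_apply]) fun a i j => by
      rw [h, h, h, e.apply_symm_apply, D_D, map_mul, map_natCast]

theorem congr_toFun {B : Type*} [CommRing B] [Algebra k B] (e : A ≃ₐ[k] B)
    (φ : ExpMap k B) (a : A) :
    (congr e φ).toFun a = (φ.toFun (e a)).map (e.symm : B →ₐ[k] A).toRingHom := rfl

theorem toFun_eq_C_of_congr {B : Type*} [CommRing B] [Algebra k B] {e : A ≃ₐ[k] B}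
    {φ : ExpMap k B} {a : A} (h : (congr e φ).toFun a = C a) : φ.toFun (e a) = C (e a) := by
  rw [congr_toFun] at h
  refine map_injective (e.symm : B →ₐ[k] A).toRingHom e.symm.injective ?_
  rw [h, map_C]
  exact congrArg C (e.symm_apply_apply a).symm

end ExpMap

variable {B : Type*} [CommRing B] [Algebra k B]

/-- An isomorphism of polynomial rings carrying constants to constants restricts to an
isomorphism of the coefficient rings. -/
theorem nonempty_algEquiv_of_map_C [IsDomain B] (e : A[X] ≃ₐ[k] B[X])
    (h : ∀ a, e (C a) = C ((e (C a)).coeff 0)) : Nonempty (A ≃ₐ[k] B) := by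
  let f : A →ₐ[k] B :=
    ((aeval (0 : B)).restrictScalars k).comp ((e : A[X] →ₐ[k] B[X]).comp CAlgHom)
  have hf : ∀ a, e (C a) = C (f a) := by
    intro a
    rw [h]
    congr 1
    change _ = aeval (0 : B) (e (C a))
    rw [coe_aeval_eq_eval, coeff_zero_eq_eval_zero]
  have hcomp : ∀ p : A[X], e p = (p.map (f : A →+* B)).comp (e X) := by
    intro p
    induction p using Polynomial.induction_on' with
    | add p q hp hq => rw [map_add, hp, hq, Polynomial.map_add, add_comp]
    | monomial n a =>
      rw [← C_mul_X_pow_eq_monomial, map_mul, map_pow, hf]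
      simp
  have hX : (e X).natDegree ≠ 0 := by
    intro h0
    have h1 := congrArg natDegree (hcomp (e.symm X))
    rw [natDegree_comp, h0, e.apply_symm_apply, natDegree_X, mul_zero] at h1
    exact one_ne_zero h1
  have hinj : Function.Injective f := fun a b hab => C_injective (e.injective (by rw [hf, hf, hab]))
  refine ⟨AlgEquiv.ofBijective f ⟨hinj, fun b => ?_⟩⟩
  have h1 := congrArg natDegree (hcomp (e.symm (C b)))
  rw [natDegree_comp, e.apply_symm_apply, natDegree_C, eq_comm, mul_eq_zero, or_iff_left hX,
    natDegree_map_eq_of_injective (f := (f : A →+* B)) hinj] at h1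
  refine ⟨(e.symm (C b)).coeff 0, C_injective ?_⟩
  rw [← hf, ← eq_C_of_natDegree_eq_zero h1, e.apply_symm_apply]

/-- Either the coefficient rings are isomorphic or the first one has a nontrivial
exponential map. -/
theorem nonempty_algEquiv_or_exists_nontrivial [IsDomain A] [IsDomain B] [Algebra.FiniteType k A]
    (e : A[X] ≃ₐ[k] B[X]) : Nonempty (A ≃ₐ[k] B) ∨ ∃ φ : ExpMap k A, φ.Nontrivial := by
  by_cases h : ∃ a, (ExpMap.congr e (.translation k B)).toFun (C a) ≠ C (C a)
  · exact .inr (ExpMap.exists_nontrivial_of_polynomial _ h)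
  · push Not at h
    exact .inl (nonempty_algEquiv_of_map_C e fun a =>
      ExpMap.translation_toFun_eq_C (ExpMap.toFun_eq_C_of_congr (h a)))

/-- The Rees algebra of a nonzero principal ideal is a polynomial ring. -/
theorem nonempty_reesAlgebra_algEquiv_polynomial {R : Type*} [CommRing R] [IsDomain R]
    [IsPrincipalIdealRing R] {J : Ideal R} (hJ : J ≠ ⊥) :
    Nonempty (reesAlgebra J ≃ₐ[R] R[X]) := by
  obtain ⟨r, hr⟩ := IsPrincipalIdealRing.principal J
  have hr0 : r ≠ 0 := by
    rintro rfl
    exact hJ (by simpa using hr)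
  refine ⟨AlgEquiv.ofRangeEq (reesAlgebra J).val (aeval (C r * X)) Subtype.val_injective ?_ ?_⟩
  · intro p q hpq
    have h : ∀ p : R[X], ∀ n, (aeval (C r * X : R[X]) p).coeff n = p.coeff n * r ^ n := by
      intro p n
      exact comp_C_mul_X_coeff
    ext n
    have h1 := congrArg (coeff · n) hpq
    simp only [h] at h1
    exact mul_right_cancel₀ (pow_ne_zero n hr0) h1
  · rw [Subalgebra.range_val, ← adjoin_monomial_eq_reesAlgebra,
      ← Algebra.adjoin_singleton_eq_range_aeval]
    apply le_antisymm
    · refine Algebra.adjoin_le ?_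
      rintro _ ⟨s, hs, rfl⟩
      rw [hr] at hs
      obtain ⟨c, rfl⟩ := Submodule.mem_span_singleton.mp hs
      rw [map_smul, ← C_mul_X_eq_monomial]
      exact Subalgebra.smul_mem _ (Algebra.subset_adjoin (Set.mem_singleton _)) c
    · have h : r ∈ J := by
        rw [hr]
        exact Submodule.mem_span_singleton_self r
      refine Algebra.adjoin_mono (Set.singleton_subset_iff.mpr ⟨r, h, ?_⟩)
      exact C_mul_X_eq_monomial.symm

/-- Rees algebras and isomorphisms of the base ring. -/
theorem exists_reesAlgebra_ringEquiv {R S : Type*} [CommRing R] [CommRing S] (g : R ≃+* S)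
    (J : Ideal S) (hJ : J ≠ ⊥) : ∃ J' : Ideal R, J' ≠ ⊥ ∧
      ∃ ρ : reesAlgebra J ≃+* reesAlgebra J',
        ∀ r, ρ (algebraMap S _ (g r)) = algebraMap R _ r := by
  have hJ' : J.map (g.symm : S →+* R) ≠ ⊥ := fun h =>
    hJ ((Ideal.map_eq_bot_iff_of_injective g.symm.injective).mp h)
  refine ⟨_, hJ', ?_⟩
  have hmem : ∀ P : S[X], P ∈ reesAlgebra J ↔
      mapEquiv g.symm P ∈ reesAlgebra (J.map (g.symm : S →+* R)) := by
    intro P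
    simp only [mem_reesAlgebra_iff, mapEquiv_apply, coeff_map, ← Ideal.map_pow]
    refine forall_congr' fun i => ?_
    constructor
    · exact fun h => Ideal.mem_map_of_mem _ h
    · intro h
      obtain ⟨s, hs, h⟩ := (Ideal.mem_map_of_equiv g.symm _).mp h
      rwa [← g.symm.injective h]
  refine ⟨RingEquiv.restrict (mapEquiv g.symm) (reesAlgebra J) (reesAlgebra _) hmem, fun r => ?_⟩
  apply Subtype.ext
  change (C (g r)).map (g.symm : S →+* R) = C r
  simp

end Cancellation

section Forms

open Polynomial TensorProduct

section Tensor

variable (k A)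

/-- Polynomial rings commute with base change. -/
noncomputable def tensorPolynomialEquiv (L : Type*) [Field L] [Algebra k L] :
    L ⊗[k] A[X] ≃ₐ[L] (L ⊗[k] A)[X] :=
  ((Algebra.TensorProduct.congr (AlgEquiv.refl : L ≃ₐ[L] L)
    ((MvPolynomial.uniqueAlgEquiv A (Fin 1)).symm.restrictScalars k)).trans
    MvPolynomial.rTensorAlgEquiv).trans
    ((MvPolynomial.uniqueAlgEquiv (L ⊗[k] A) (Fin 1)).restrictScalars L)

end Tensor

variable {L : Type*} [Field L] [Algebra k L] {B : Type*} [CommRing B] [Algebra k B]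

theorem finiteType_of_cylinder (σ : (L ⊗[k] A)[X] ≃ₐ[L] MvPolynomial (Fin 3) L) :
    Algebra.FiniteType k A := by
  have : Algebra.FiniteType L (L ⊗[k] A) := by
    refine Algebra.FiniteType.of_surjective
      (((aeval (0 : L ⊗[k] A)).restrictScalars L).comp
        (σ.symm : MvPolynomial (Fin 3) L →ₐ[L] (L ⊗[k] A)[X])) fun a => ?_
    refine ⟨σ (C a), ?_⟩
    change aeval (0 : L ⊗[k] A) (σ.symm (σ (C a))) = a
    rw [σ.symm_apply_apply, aeval_C]
    rfl
  exact Algebra.FiniteType.of_finiteType_tensorProduct_of_faithfullyFlat L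

/-- The cylinder condition passes between algebras with isomorphic polynomial rings. -/
noncomputable def cylinderCongr (σ : (L ⊗[k] A)[X] ≃ₐ[L] MvPolynomial (Fin 3) L)
    (e : A[X] ≃ₐ[k] B[X]) : (L ⊗[k] B)[X] ≃ₐ[L] MvPolynomial (Fin 3) L :=
  (((tensorPolynomialEquiv k B L).symm.trans
    (Algebra.TensorProduct.congr (AlgEquiv.refl : L ≃ₐ[L] L) e.symm)).trans
    (tensorPolynomialEquiv k A L)).trans σ

/-- A form of the plane over `L` is one over any extension of `L`, stated for cylinders. -/
theorem nonempty_cylinder (M : Type*) [Field M] [Algebra L M] [Algebra k M] [IsScalarTower k L M]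
    (θ : L ⊗[k] A ≃ₐ[L] MvPolynomial (Fin 2) L) :
    Nonempty ((M ⊗[k] A)[X] ≃ₐ[M] MvPolynomial (Fin 3) M) :=
  let θ' : M ⊗[k] A ≃ₐ[M] MvPolynomial (Fin 2) M :=
    ((Algebra.TensorProduct.cancelBaseChange k L M M A).symm.trans
      (Algebra.TensorProduct.congr AlgEquiv.refl θ)).trans
      (MvPolynomial.algebraTensorAlgEquiv L M)
  ⟨(mapAlgEquiv θ').trans (MvPolynomial.finSuccEquiv M 2).symm⟩

theorem exists_forall_ne_algebraMap {E : Type*} [CommRing E] [Algebra k E]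
    (θ : L ⊗[k] E ≃ₐ[L] L[X]) : ∃ e : E, ∀ c, algebraMap k E c ≠ e := by
  by_contra! h
  have hs : ∀ x : L ⊗[k] E, ∃ l, algebraMap L _ l = x := by
    intro x
    induction x with
    | zero => exact ⟨0, map_zero _⟩
    | add x y hx hy =>
      obtain ⟨l, rfl⟩ := hx
      obtain ⟨m, rfl⟩ := hy
      exact ⟨l + m, map_add _ _ _⟩
    | tmul l e =>
      obtain ⟨c, rfl⟩ := h e
      refine ⟨c • l, ?_⟩
      rw [Algebra.TensorProduct.algebraMap_apply, Algebra.algebraMap_eq_smul_one c,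
        ← TensorProduct.smul_tmul]
      rfl
  obtain ⟨l, hl⟩ := hs (θ.symm X)
  have h1 := congrArg θ hl
  rw [AlgEquiv.commutes, θ.apply_symm_apply] at h1
  have h2 := congrArg natDegree h1
  rw [natDegree_X, Polynomial.algebraMap_apply, natDegree_C] at h2
  exact zero_ne_one h2

/-- A form of the line inside a polynomial ring is a polynomial ring. -/
theorem nonempty_algEquiv_polynomial_of_injective {E : Type*} [CommRing E] [Algebra k E]
    (θ : L ⊗[k] E ≃ₐ[L] L[X]) {ι : Type*} (f : E →ₐ[k] MvPolynomial ι k)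
    (hf : Function.Injective f) : Nonempty (E ≃ₐ[k] k[X]) := by
  have : IsDomain (L ⊗[k] MvPolynomial ι k) :=
    (MvPolynomial.algebraTensorAlgEquiv k L).toMulEquiv.isDomain
  let s : MvPolynomial ι k →ₐ[k] (MvPolynomial ι k)[X] :=
    MvPolynomial.aeval fun i => C (MvPolynomial.X i) * X
  obtain ⟨e, he⟩ := exists_forall_ne_algebraMap θ
  refine nonempty_algEquiv_polynomial θ (s.comp f) ⟨e, Nat.pos_of_ne_zero fun h => ?_⟩
  have h1 : ∀ p, (s p).eval 1 = p := by
    intro p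
    have : (((aeval (1 : MvPolynomial ι k)).restrictScalars k).comp s) = AlgHom.id k _ := by
      ext i : 1
      simp [s]
    exact AlgHom.congr_fun this p
  have h0 : ∀ p, (s p).eval 0 = algebraMap k _ (MvPolynomial.constantCoeff p) := by
    intro p
    have : (((aeval (0 : MvPolynomial ι k)).restrictScalars k).comp s) =
        (Algebra.ofId k _).comp (MvPolynomial.aeval fun _ => 0) := by
      ext i : 1
      simp [s]
    have := AlgHom.congr_fun this p
    simp only [AlgHom.comp_apply, AlgHom.restrictScalars_apply, coe_aeval_eq_eval] at this
    rw [this, Algebra.ofId_apply]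
    congr 1
    exact MvPolynomial.aeval_zero' _
  have h2 : (s (f e)).eval 1 = (s (f e)).eval 0 := by
    rw [AlgHom.comp_apply] at h
    rw [eq_C_of_natDegree_eq_zero h, eval_C, eval_C]
  rw [h1, h0] at h2
  refine he (MvPolynomial.constantCoeff (f e)) (hf ?_)
  rw [AlgHom.commutes, ← h2]

namespace ExpMap

theorem nonempty_algEquiv_of_invariants [IsAlgClosed L] {φ : ExpMap k A}
    (σ : (L ⊗[k] A)[X] ≃ₐ[L] MvPolynomial (Fin 3) L) (hφ : φ.Nontrivial)
    (h : Nonempty (φ.invariants ≃ₐ[k] k[X])) : Nonempty (A ≃ₐ[k] k[X][X]) := by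
  have := isDomain_of_cylinder σ
  have : IsDomain A := ExpMap.isDomain_of_tensor (k := k) (A := A) (L := L)
  obtain ⟨J, hJ, ⟨ρ⟩⟩ := exists_algEquiv_reesAlgebra σ hφ
  obtain ⟨g⟩ := h
  have : IsPrincipalIdealRing φ.invariants :=
    IsPrincipalIdealRing.of_surjective (g.symm : k[X] →+* φ.invariants) g.symm.surjective
  obtain ⟨ρ'⟩ := nonempty_reesAlgebra_algEquiv_polynomial hJ
  exact ⟨((ρ.trans ρ').restrictScalars k).trans (mapAlgEquiv g)⟩

theorem nonempty_algEquiv_of_invariants_left [IsAlgClosed L] {φ : ExpMap k A} {ψ : ExpMap k B}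
    (σ : (L ⊗[k] A)[X] ≃ₐ[L] MvPolynomial (Fin 3) L)
    (σ' : (L ⊗[k] B)[X] ≃ₐ[L] MvPolynomial (Fin 3) L) (hφ : φ.Nontrivial) (hψ : ψ.Nontrivial)
    (e : A[X] ≃ₐ[k] B[X]) (h : Nonempty (φ.invariants ≃ₐ[k] k[X])) : Nonempty (A ≃ₐ[k] B) := by
  obtain ⟨α⟩ := nonempty_algEquiv_of_invariants σ hφ h
  let τ : k[X][X][X] ≃ₐ[k] MvPolynomial (Fin 3) k :=
    (mapAlgEquiv ((mapAlgEquiv (MvPolynomial.uniqueAlgEquiv k (Fin 1)).symm).trans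
      (MvPolynomial.finSuccEquiv k 1).symm)).trans (MvPolynomial.finSuccEquiv k 2).symm
  let β : B[X] ≃ₐ[k] MvPolynomial (Fin 3) k := (e.symm.trans (mapAlgEquiv α)).trans τ
  obtain ⟨θ⟩ := nonempty_polynomial_algEquiv_tensor_invariants σ' hψ
  obtain ⟨α'⟩ := nonempty_algEquiv_of_invariants σ' hψ
    (nonempty_algEquiv_polynomial_of_injective θ
      (((β : B[X] →ₐ[k] MvPolynomial (Fin 3) k).comp CAlgHom).comp ψ.invariants.val)
      ((β.injective.comp C_injective).comp Subtype.val_injective))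
  exact ⟨α.trans α'.symm⟩

theorem exists_invariants_algHom [IsAlgClosed L] {φ : ExpMap k A} {ψ : ExpMap k B}
    (σ : (L ⊗[k] A)[X] ≃ₐ[L] MvPolynomial (Fin 3) L)
    (σ' : (L ⊗[k] B)[X] ≃ₐ[L] MvPolynomial (Fin 3) L) (hφ : φ.Nontrivial)
    (e : A[X] ≃ₐ[k] B[X]) (h : ¬ Nonempty (φ.invariants ≃ₐ[k] k[X])) :
    ∃ g : φ.invariants →ₐ[k] ψ.invariants, ∀ c : φ.invariants, e (C (c : A)) = C (g c : B) := by
  have := isDomain_of_cylinder σ'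
  obtain ⟨θ⟩ := nonempty_polynomial_algEquiv_tensor_invariants σ hφ
  have hdeg : ∀ (f : φ.invariants →ₐ[k] B[X]) c, (f c).natDegree = 0 := by
    intro f c
    by_contra h0
    exact h (nonempty_algEquiv_polynomial θ f ⟨c, Nat.pos_of_ne_zero h0⟩)
  let f : φ.invariants →ₐ[k] B[X] := ((e : A[X] →ₐ[k] B[X]).comp CAlgHom).comp φ.invariants.val
  let g : φ.invariants →ₐ[k] B := ((aeval (0 : B)).restrictScalars k).comp f
  have hg : ∀ c : φ.invariants, e (C (c : A)) = C (g c) := by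
    intro c
    change f c = C (aeval (0 : B) (f c))
    rw [coe_aeval_eq_eval, ← coeff_zero_eq_eval_zero]
    exact eq_C_of_natDegree_eq_zero (hdeg f c)
  exact ⟨g.codRestrict ψ.invariants fun c => mem_invariants_iff_deg.mpr
    (hdeg (ψ.toFun.comp g) c), hg⟩

theorem exists_invariants_algEquiv [IsAlgClosed L] {φ : ExpMap k A} {ψ : ExpMap k B}
    (σ : (L ⊗[k] A)[X] ≃ₐ[L] MvPolynomial (Fin 3) L)
    (σ' : (L ⊗[k] B)[X] ≃ₐ[L] MvPolynomial (Fin 3) L) (hφ : φ.Nontrivial) (hψ : ψ.Nontrivial)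
    (e : A[X] ≃ₐ[k] B[X]) (h : ¬ Nonempty (φ.invariants ≃ₐ[k] k[X]))
    (h' : ¬ Nonempty (ψ.invariants ≃ₐ[k] k[X])) :
    ∃ g : φ.invariants ≃ₐ[k] ψ.invariants, ∀ c : φ.invariants, e (C (c : A)) = C (g c : B) := by
  obtain ⟨g, hg⟩ := exists_invariants_algHom (ψ := ψ) σ σ' hφ e h
  obtain ⟨g', hg'⟩ := exists_invariants_algHom (ψ := φ) σ' σ hψ e.symm h'
  refine ⟨AlgEquiv.ofAlgHom g g' ?_ ?_, hg⟩
  · ext c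
    refine C_injective ?_
    rw [AlgHom.comp_apply, ← hg, ← hg', e.apply_symm_apply]
    rfl
  · ext c
    refine C_injective ?_
    rw [AlgHom.comp_apply, ← hg', ← hg, e.symm_apply_apply]
    rfl

end ExpMap

/-- Cancellation for algebras that become cancellative planes over an algebraically closed
field. -/
theorem nonempty_algEquiv_of_cylinder [IsAlgClosed L]
    (σ : (L ⊗[k] A)[X] ≃ₐ[L] MvPolynomial (Fin 3) L) (e : A[X] ≃ₐ[k] B[X]) :
    Nonempty (A ≃ₐ[k] B) := by
  let σ' := cylinderCongr σ e
  have := isDomain_of_cylinder σ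
  have := isDomain_of_cylinder σ'
  have : IsDomain A := ExpMap.isDomain_of_tensor (k := k) (A := A) (L := L)
  have : IsDomain B := ExpMap.isDomain_of_tensor (k := k) (A := B) (L := L)
  have := finiteType_of_cylinder σ
  have := finiteType_of_cylinder σ'
  obtain h | ⟨φ, hφ⟩ := nonempty_algEquiv_or_exists_nontrivial e
  · exact h
  obtain ⟨⟨h⟩⟩ | ⟨ψ, hψ⟩ := nonempty_algEquiv_or_exists_nontrivial e.symm
  · exact ⟨h.symm⟩
  by_cases hC : Nonempty (φ.invariants ≃ₐ[k] k[X])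
  · exact ExpMap.nonempty_algEquiv_of_invariants_left σ σ' hφ hψ e hC
  by_cases hD : Nonempty (ψ.invariants ≃ₐ[k] k[X])
  · obtain ⟨h⟩ := ExpMap.nonempty_algEquiv_of_invariants_left σ' σ hψ hφ e.symm hD
    exact ⟨h.symm⟩
  obtain ⟨g, hg⟩ := ExpMap.exists_invariants_algEquiv σ σ' hφ hψ e hC hD
  obtain ⟨J, hJ, ⟨α⟩⟩ := ExpMap.exists_algEquiv_reesAlgebra σ hφ
  obtain ⟨J', hJ', ⟨β⟩⟩ := ExpMap.exists_algEquiv_reesAlgebra σ' hψ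
  obtain ⟨I, hI, ρ, hρ⟩ := exists_reesAlgebra_ringEquiv (g : φ.invariants ≃+* ψ.invariants) J' hJ'
  let γ : B ≃+* reesAlgebra I := (β : B ≃+* reesAlgebra J').trans ρ
  have hγ : ∀ c : φ.invariants, γ (g c : B) = algebraMap _ _ c := by
    intro c
    rw [← hρ]
    exact congrArg ρ (β.commutes (g c))
  let Θ : (reesAlgebra J)[X] ≃ₐ[φ.invariants] (reesAlgebra I)[X] :=
    AlgEquiv.ofRingEquiv (f := ((mapEquiv (α.symm : reesAlgebra J ≃+* A)).trans
      (e : A[X] ≃+* B[X])).trans (mapEquiv γ)) fun c => by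
        change (e ((C (algebraMap _ _ c)).map
          ((α.symm : reesAlgebra J ≃+* A) : reesAlgebra J →+* A))).map
          (γ : B →+* reesAlgebra I) = C (algebraMap _ _ c)
        have h : ((α.symm : reesAlgebra J ≃+* A) : reesAlgebra J →+* A) (algebraMap _ _ c) =
          (c : A) := α.symm.commutes c
        rw [map_C, h, hg, map_C, ← hγ]
        rfl
  obtain ⟨δ⟩ := nonempty_reesAlgebra_algEquiv hJ hI Θ
  refine ⟨AlgEquiv.ofRingEquiv (f := ((α : A ≃+* reesAlgebra J).trans
    (δ : reesAlgebra J ≃+* reesAlgebra I)).trans γ.symm) fun r => ?_⟩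
  change γ.symm (δ (α (algebraMap k A r))) = algebraMap k B r
  rw [RingEquiv.symm_apply_eq]
  have h1 : algebraMap k A r = algebraMap φ.invariants A (algebraMap k φ.invariants r) := rfl
  have h2 : algebraMap k B r = (g (algebraMap k φ.invariants r) : B) := by
    rw [g.commutes]
    rfl
  rw [h1, α.commutes, δ.commutes, h2, hγ]

end Forms

/-- Theorem C: `𝔸²`-forms over a field are cancellative: if `A` is an
`𝔸²`-form over `k` and `B` is any `k`-algebra with `A^{[1]} ≅_k B^{[1]}`, then `A ≅_k B`. -/
theorem cancellation_of_forms (L : Type*) [Field L] [Algebra k L]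
    (hform : Nonempty ((TensorProduct k L A) ≃ₐ[L] MvPolynomial (Fin 2) L))
    (B : Type*) [CommRing B] [Algebra k B]
    (hcanc : Nonempty (Polynomial A ≃ₐ[k] Polynomial B)) :
    Nonempty (A ≃ₐ[k] B) := by
  obtain ⟨θ⟩ := hform
  obtain ⟨e⟩ := hcanc
  obtain ⟨σ⟩ := nonempty_cylinder (AlgebraicClosure L) θ
  exact nonempty_algEquiv_of_cylinder σ e
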